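/- arXiv:1608.04122 — 11 statements merged into one kernel-verified Lean document; each statement's English description precedes it below -/
import Mathlib

section
/- Let V ⊆ ℝ³ be a bounded open set and let A¹, A² : W → ℝ be smooth functions on an open set W containing the closure of V. Suppose that for every x in Σ ∩ V, where Σ ∩ V = {x ∈ V : x₃ = 0}, the Martinet relation ∂₂A¹(x) − ∂₁A²(x) + A¹(x)·∂₃A²(x) − A²(x)·∂₃A¹(x) = 0 holds. Define Z(x) = (−A²(x), A¹(x), 0). Then there exists K > 0 such that |∂₂A¹(x) − ∂₁A²(x)| ≤ K·‖Z(x)‖ for every x ∈ Σ ∩ V, i.e. the divergence of Z is controlled by its norm on Σ ∩ V. -/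
/-- Euclidean partial derivative `∂ᵢ f` on `ℝ³ = (Fin 3 → ℝ)`. -/
noncomputable def pd (i : Fin 3) (f : (Fin 3 → ℝ) → ℝ) (x : Fin 3 → ℝ) : ℝ :=
  fderiv ℝ f x (Pi.single i 1)

/-- Partial derivatives of a `C¹` function are bounded on compact subsets of its open domain. -/
theorem exists_abs_pd_le {W S : Set (Fin 3 → ℝ)} (hW : IsOpen W) (hS : IsCompact S) (hSW : S ⊆ W)
    {f : (Fin 3 → ℝ) → ℝ} (hf : ContDiffOn ℝ 1 f W) (i : Fin 3) :
    ∃ C, ∀ x ∈ S, |pd i f x| ≤ C := by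
  have hcont : ContinuousOn (pd i f) W :=
    (hf.continuousOn_fderiv_of_isOpen hW le_rfl).clm_apply continuousOn_const
  exact hS.exists_bound_of_continuousOn (hcont.mono hSW)

/-- on a bounded open set whose closure is contained in the domain of
smoothness, the divergence of `Z = (−A², A¹, 0)` is controlled by its norm on the
Martinet surface `{x₃ = 0}`. -/
theorem stmt1 (V W : Set (Fin 3 → ℝ)) (hVopen : IsOpen V) (hVbdd : Bornology.IsBounded V)
    (hWopen : IsOpen W) (hVW : closure V ⊆ W)
    (A1 A2 : (Fin 3 → ℝ) → ℝ)
    (hA1 : ContDiffOn ℝ (⊤ : ℕ∞) A1 W) (hA2 : ContDiffOn ℝ (⊤ : ℕ∞) A2 W)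
    (hMart : ∀ x ∈ V, x 2 = 0 →
      pd 1 A1 x - pd 0 A2 x + A1 x * pd 2 A2 x - A2 x * pd 2 A1 x = 0) :
    ∃ K > 0, ∀ x ∈ V, x 2 = 0 →
      |pd 1 A1 x - pd 0 A2 x| ≤ K * Real.sqrt ((A1 x) ^ 2 + (A2 x) ^ 2) := by
  have hS : IsCompact (closure V) := hVbdd.isCompact_closure
  obtain ⟨C1, hC1⟩ := exists_abs_pd_le hWopen hS hVW (hA1.of_le (mod_cast le_top)) 2
  obtain ⟨C2, hC2⟩ := exists_abs_pd_le hWopen hS hVW (hA2.of_le (mod_cast le_top)) 2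
  refine ⟨|C1| + |C2| + 1, by positivity, fun x hx hx0 => ?_⟩
  have h1 : |pd 2 A1 x| ≤ |C1| := (hC1 x (subset_closure hx)).trans (le_abs_self C1)
  have h2 : |pd 2 A2 x| ≤ |C2| := (hC2 x (subset_closure hx)).trans (le_abs_self C2)
  set r := Real.sqrt ((A1 x) ^ 2 + (A2 x) ^ 2)
  have hr0 : 0 ≤ r := Real.sqrt_nonneg _
  have hA1r : |A1 x| ≤ r := Real.abs_le_sqrt (by nlinarith [sq_nonneg (A2 x)])
  have hA2r : |A2 x| ≤ r := Real.abs_le_sqrt (by nlinarith [sq_nonneg (A1 x)])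
  have hdiv : pd 1 A1 x - pd 0 A2 x = A2 x * pd 2 A1 x - A1 x * pd 2 A2 x := by
    linarith [hMart x hx hx0]
  calc |pd 1 A1 x - pd 0 A2 x| ≤ |A2 x * pd 2 A1 x| + |A1 x * pd 2 A2 x| :=
        hdiv ▸ abs_sub _ _
    _ = |A2 x| * |pd 2 A1 x| + |A1 x| * |pd 2 A2 x| := by rw [abs_mul, abs_mul]
    _ ≤ r * |C1| + r * |C2| := by gcongr
    _ ≤ (|C1| + |C2| + 1) * r := by linarith
end

section
/- Let V ⊆ ℝ³ be a bounded open set and let h, A : W → ℝ be smooth functions on an open set W containing the closure of V. Define the vector field Z on W by Z = (−(∂₂h + A·∂₃h), ∂₁h, ∂₁h·A), i.e. Z = (∂₁h)(∂₂ + A∂₃) − (∂₂h + A∂₃h)∂₁. Then: (i) identically on W, div Z = ∂₁h·∂₃A − ∂₁A·∂₃h; and (ii) if moreover ∂₁A(x) = 0 for every x ∈ W with h(x) = 0, then there exists K > 0 such that |div Z(x)| ≤ K·‖Z(x)‖ for every x ∈ {h = 0} ∩ V. -/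
theorem ContDiffAt.differentiableAt_pd {f : (Fin 3 → ℝ) → ℝ} {x : Fin 3 → ℝ}
    (hf : ContDiffAt ℝ 2 f x) (i : Fin 3) : DifferentiableAt ℝ (pd i f) x :=
  ((hf.fderiv_right (m := 1) (by norm_num)).differentiableAt one_ne_zero).clm_apply
    (differentiableAt_const _)

theorem ContDiffAt.pd_comm {f : (Fin 3 → ℝ) → ℝ} {x : Fin 3 → ℝ}
    (hf : ContDiffAt ℝ 2 f x) (i j : Fin 3) : pd i (pd j f) x = pd j (pd i f) x := by
  have hd : DifferentiableAt ℝ (fderiv ℝ f) x :=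
    (hf.fderiv_right (m := 1) (by norm_num)).differentiableAt one_ne_zero
  have key (i j : Fin 3) :
      pd i (pd j f) x = fderiv ℝ (fderiv ℝ f) x (Pi.single i 1) (Pi.single j 1) := by
    change fderiv ℝ (fun y => fderiv ℝ f y (Pi.single j 1)) x (Pi.single i 1) = _
    rw [fderiv_clm_apply hd (differentiableAt_const _)]
    simp
  rw [key, key]
  exact hf.isSymmSndFDerivAt (by simp) _ _

theorem pd_neg (f : (Fin 3 → ℝ) → ℝ) (x : Fin 3 → ℝ) (i : Fin 3) :
    pd i (fun y => -f y) x = -pd i f x := by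
  simp [pd, fderiv_fun_neg]

theorem pd_add {f g : (Fin 3 → ℝ) → ℝ} {x : Fin 3 → ℝ} (hf : DifferentiableAt ℝ f x)
    (hg : DifferentiableAt ℝ g x) (i : Fin 3) :
    pd i (fun y => f y + g y) x = pd i f x + pd i g x := by
  simp [pd, fderiv_fun_add hf hg]

theorem pd_mul {f g : (Fin 3 → ℝ) → ℝ} {x : Fin 3 → ℝ} (hf : DifferentiableAt ℝ f x)
    (hg : DifferentiableAt ℝ g x) (i : Fin 3) :
    pd i (fun y => f y * g y) x = f x * pd i g x + g x * pd i f x := by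
  simp [pd, fderiv_fun_mul hf hg]

theorem ContDiffOn.continuousOn_pd {f : (Fin 3 → ℝ) → ℝ} {W : Set (Fin 3 → ℝ)}
    (hf : ContDiffOn ℝ 1 f W) (hW : IsOpen W) (i : Fin 3) : ContinuousOn (pd i f) W :=
  (hf.continuousOn_fderiv_of_isOpen hW le_rfl).clm_apply continuousOn_const

/-- The divergence of `Z = (X·h)Y − (Y·h)X` at a point. -/
theorem divergence_trace_field {h A : (Fin 3 → ℝ) → ℝ} {x : Fin 3 → ℝ}
    (hh : ContDiffAt ℝ 2 h x) (hA : DifferentiableAt ℝ A x) :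
    pd 0 (fun y => -(pd 1 h y + A y * pd 2 h y)) x
        + pd 1 (fun y => pd 0 h y) x + pd 2 (fun y => pd 0 h y * A y) x
      = pd 0 h x * pd 2 A x - pd 0 A x * pd 2 h x := by
  have hd := hh.differentiableAt_pd
  rw [pd_neg, pd_add (hd 1) (hA.fun_mul (hd 2)), pd_mul hA (hd 2), pd_mul (hd 0) hA,
    hh.pd_comm 0 1, hh.pd_comm 0 2]
  ring

/-- for `Z = (X·h)Y − (Y·h)X` with `X = ∂₁`, `Y = ∂₂ + A∂₃`, i.e.
`Z = (−(∂₂h + A∂₃h), ∂₁h, ∂₁h·A)`: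
(i) `div Z = ∂₁h·∂₃A − ∂₁A·∂₃h` identically on `W`; and
(ii) if `∂₁A = 0` on `{h = 0} ∩ W`, then `|div Z| ≤ K‖Z‖` on `{h = 0} ∩ V`. -/
theorem stmt2 (V W : Set (Fin 3 → ℝ)) (hVopen : IsOpen V) (hVbdd : Bornology.IsBounded V)
    (hWopen : IsOpen W) (hVW : closure V ⊆ W)
    (h A : (Fin 3 → ℝ) → ℝ)
    (hh : ContDiffOn ℝ (⊤ : ℕ∞) h W) (hA : ContDiffOn ℝ (⊤ : ℕ∞) A W) :
    (∀ x ∈ W,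
      pd 0 (fun y => -(pd 1 h y + A y * pd 2 h y)) x
        + pd 1 (fun y => pd 0 h y) x + pd 2 (fun y => pd 0 h y * A y) x
      = pd 0 h x * pd 2 A x - pd 0 A x * pd 2 h x)
    ∧ ((∀ x ∈ W, h x = 0 → pd 0 A x = 0) →
        ∃ K > 0, ∀ x ∈ V, h x = 0 →
          |pd 0 (fun y => -(pd 1 h y + A y * pd 2 h y)) x
            + pd 1 (fun y => pd 0 h y) x + pd 2 (fun y => pd 0 h y * A y) x|
          ≤ K * Real.sqrt ((pd 1 h x + A x * pd 2 h x) ^ 2 + (pd 0 h x) ^ 2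
              + (pd 0 h x * A x) ^ 2)) := by
  have hdiv : ∀ x ∈ W,
      pd 0 (fun y => -(pd 1 h y + A y * pd 2 h y)) x
        + pd 1 (fun y => pd 0 h y) x + pd 2 (fun y => pd 0 h y * A y) x
      = pd 0 h x * pd 2 A x - pd 0 A x * pd 2 h x := fun x hx =>
    divergence_trace_field
      ((hh.contDiffAt (hWopen.mem_nhds hx)).of_le (WithTop.coe_le_coe.2 le_top))
      ((hA.contDiffAt (hWopen.mem_nhds hx)).differentiableAt (by simp))
  refine ⟨hdiv, fun hmart => ?_⟩
  have hcont : ContinuousOn (pd 2 A) (closure V) :=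
    ((hA.of_le (by exact_mod_cast le_top)).continuousOn_pd hWopen 2).mono hVW
  obtain ⟨C, hC⟩ := hVbdd.isCompact_closure.exists_bound_of_continuousOn hcont
  refine ⟨max C 1, by positivity, fun x hx hx0 => ?_⟩
  have hxc := subset_closure hx
  rw [hdiv x (hVW hxc), hmart x (hVW hxc) hx0, zero_mul, sub_zero, abs_mul, mul_comm]
  gcongr
  · exact (hC x hxc).trans (le_max_left _ _)
  · exact Real.abs_le_sqrt (by
      linarith [sq_nonneg (pd 1 h x + A x * pd 2 h x), sq_nonneg (pd 0 h x * A x)])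
end

section
/- Let Z : ℝⁿ → ℝⁿ be a C¹ vector field admitting a global flow φ : [0,∞) × ℝⁿ → ℝⁿ (φ(0,x) = x and ∂ₜφ(t,x) = Z(φ(t,x))). Let S ⊆ ℝⁿ be a Borel set of finite Lebesgue measure, and let K, C > 0 be constants such that |div Z(y)| ≤ K·‖Z(y)‖ for every point y of the form y = φ(s, x) with x ∈ S, s ≥ 0, and such that ∫₀^∞ ‖Z(φ(s, x))‖ ds ≤ C for every x ∈ S. Then for every t ≥ 0, the Lebesgue measure of φₜ(S) is at least e^{−KC} times the Lebesgue measure of S. In particular, if the Lebesgue measure of φₜ(S) tends to 0 as t → ∞, then S has Lebesgue measure zero. -/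
open MeasureTheory

/-- Euclidean divergence of a vector field on `ℝⁿ`. -/
noncomputable def dvg {n : ℕ} (Z : EuclideanSpace ℝ (Fin n) → EuclideanSpace ℝ (Fin n))
    (y : EuclideanSpace ℝ (Fin n)) : ℝ :=
  ∑ i, fderiv ℝ (fun x => Z x i) y (EuclideanSpace.single i 1)

/-- The radial retraction onto the closed ball of radius `R` is `2`-Lipschitz. -/
theorem norm_radialRetraction_sub_le {F : Type*} [NormedAddCommGroup F] [NormedSpace ℝ F]
    {R : ℝ} (hR : 0 < R) (u v : F) :
    ‖(R / max R ‖u‖) • u - (R / max R ‖v‖) • v‖ ≤ 2 * ‖u - v‖ := by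
  have hu : 0 < max R ‖u‖ := lt_max_of_lt_left hR
  have hv : 0 < max R ‖v‖ := lt_max_of_lt_left hR
  have hsplit : (R / max R ‖u‖) • u - (R / max R ‖v‖) • v
      = (R / max R ‖u‖) • (u - v) + (R / max R ‖u‖ - R / max R ‖v‖) • v := by
    module
  have hcoef : R / max R ‖u‖ ≤ 1 := (div_le_one hu).2 (le_max_left _ _)
  have hmax : |max R ‖v‖ - max R ‖u‖| ≤ ‖u - v‖ := by
    rw [max_comm R, max_comm R, norm_sub_rev]
    exact (abs_max_sub_max_le_abs _ _ _).trans (abs_norm_sub_norm_le _ _)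
  have hdiff : |R / max R ‖u‖ - R / max R ‖v‖| * ‖v‖ ≤ ‖u - v‖ := by
    have heq : R / max R ‖u‖ - R / max R ‖v‖
        = R / max R ‖u‖ * ((max R ‖v‖ - max R ‖u‖) / max R ‖v‖) := by
      field_simp
    rw [heq, abs_mul, abs_of_pos (div_pos hR hu), abs_div, abs_of_pos hv]
    calc R / max R ‖u‖ * (|max R ‖v‖ - max R ‖u‖| / max R ‖v‖) * ‖v‖
        = R / max R ‖u‖ * (|max R ‖v‖ - max R ‖u‖| * (‖v‖ / max R ‖v‖)) := by ring
      _ ≤ 1 * (‖u - v‖ * 1) := by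
        gcongr
        exact (div_le_one hv).2 (le_max_right _ _)
      _ = ‖u - v‖ := by ring
  calc ‖(R / max R ‖u‖) • u - (R / max R ‖v‖) • v‖
      ≤ R / max R ‖u‖ * ‖u - v‖ + |R / max R ‖u‖ - R / max R ‖v‖| * ‖v‖ := by
        rw [hsplit]
        refine (norm_add_le _ _).trans_eq ?_
        rw [norm_smul, norm_smul, Real.norm_eq_abs, Real.norm_eq_abs, abs_of_pos (div_pos hR hu)]
    _ ≤ 1 * ‖u - v‖ + ‖u - v‖ := by gcongr
    _ = 2 * ‖u - v‖ := by ring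

open Set in
theorem HasDerivWithinAt.Ici_of_Icc {F : Type*} [NormedAddCommGroup F] [NormedSpace ℝ F]
    {f : ℝ → F} {f' : F} {a b t : ℝ} (h : HasDerivWithinAt f f' (Icc a b) t) (ht : t ∈ Ico a b) :
    HasDerivWithinAt f f' (Ici t) t :=
  h.mono_of_mem_nhdsWithin (Icc_mem_nhdsGE_of_mem ht)

open Set in
/-- A linear ordinary differential equation with continuous coefficients on `[0, T]` has a solution
on all of `[0, T]`. -/
theorem exists_hasDerivWithinAt_linear {F : Type*} [NormedAddCommGroup F] [NormedSpace ℝ F]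
    [CompleteSpace F] {T : ℝ} (hT : 0 ≤ T) {B : ℝ → F →L[ℝ] F} (hB : ContinuousOn B (Icc 0 T))
    (u₀ : F) :
    ∃ u : ℝ → F, u 0 = u₀ ∧ ∀ t ∈ Icc 0 T, HasDerivWithinAt u (B t (u t)) (Icc 0 T) t := by
  obtain ⟨L, hL⟩ := isCompact_Icc.exists_bound_of_continuousOn hB
  have hL0 : 0 ≤ L := (norm_nonneg _).trans (hL 0 ⟨le_rfl, hT⟩)
  set R : ℝ := ‖u₀‖ * Real.exp (L * T) + 1 with hRdef
  have hR : 0 < R := by positivity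
  let f : ℝ → F → F := fun t u => B t ((R / max R ‖u‖) • u)
  have hnorm (u : F) : ‖(R / max R ‖u‖) • u‖ = R / max R ‖u‖ * ‖u‖ := by
    rw [norm_smul, Real.norm_of_nonneg (by positivity)]
  have hle (u : F) : ‖(R / max R ‖u‖) • u‖ ≤ ‖u‖ := by
    rw [hnorm]
    exact mul_le_of_le_one_left (norm_nonneg _)
      ((div_le_one (lt_max_of_lt_left hR)).2 (le_max_left _ _))
  have hleR (u : F) : ‖(R / max R ‖u‖) • u‖ ≤ R := by
    rw [hnorm, div_mul_eq_mul_div, div_le_iff₀ (lt_max_of_lt_left hR)]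
    gcongr
    exact le_max_right _ _
  have hPL : IsPicardLindelof f (⟨0, le_rfl, hT⟩ : Icc (0 : ℝ) T) u₀ (L * R * T).toNNReal 0
      (L * R).toNNReal (L * 2).toNNReal := by
    refine ⟨fun t ht => ?_, fun u _ => hB.clm_apply continuousOn_const, fun t ht u _ => ?_, ?_⟩
    · refine LipschitzWith.lipschitzOnWith (LipschitzWith.of_dist_le_mul fun u v => ?_)
      rw [dist_eq_norm, dist_eq_norm, Real.coe_toNNReal _ (by positivity), ← map_sub, mul_assoc]
      exact (B t).le_of_opNorm_le_of_le (hL t ht) (norm_radialRetraction_sub_le hR u v)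
    · rw [Real.coe_toNNReal _ (by positivity)]
      exact (B t).le_of_opNorm_le_of_le (hL t ht) (hleR u)
    · rw [Real.coe_toNNReal _ (by positivity), Real.coe_toNNReal _ (by positivity)]
      simp [hT]
  obtain ⟨u, hu0, hu⟩ := hPL.exists_eq_forall_mem_Icc_hasDerivWithinAt₀
  refine ⟨u, hu0, fun t ht => ?_⟩
  have hgron := norm_le_gronwallBound_of_norm_deriv_right_le (δ := ‖u₀‖) (K := L) (ε := 0)
    (fun t ht => (hu t ht).continuousWithinAt)
    (fun t ht => (hu t (Ico_subset_Icc_self ht)).Ici_of_Icc ht) (by simp_all)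
    (fun t ht => by
      rw [add_zero]
      exact (B t).le_of_opNorm_le_of_le (hL t (Ico_subset_Icc_self ht)) (hle _)) t ht
  rw [gronwallBound_ε0, sub_zero] at hgron
  have huR : ‖u t‖ ≤ R := by
    have : ‖u₀‖ * Real.exp (L * t) ≤ ‖u₀‖ * Real.exp (L * T) := by
      gcongr
      exact ht.2
    linarith
  have := hu t ht
  simpa only [f, max_eq_left huR, div_self hR.ne', one_smul] using this

/-- **Jacobi's formula** along a solution of the matrix equation `M' = A M`. -/
theorem Matrix.hasDerivWithinAt_det {ι : Type*} [Fintype ι] [DecidableEq ι]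
    {M : ℝ → Matrix ι ι ℝ} {A : Matrix ι ι ℝ} {s : Set ℝ} {t : ℝ}
    (hM : ∀ i j, HasDerivWithinAt (fun τ => M τ i j) ((A * M t) i j) s t) :
    HasDerivWithinAt (fun τ => (M τ).det) (A.trace * (M t).det) s t := by
  let D : ContinuousMultilinearMap ℝ (fun _ : ι => ι → ℝ) ℝ :=
    ⟨(Matrix.detRowAlternating (n := ι) (R := ℝ)).toMultilinearMap,
      Continuous.matrix_det (A := fun M : Matrix ι ι ℝ => M) continuous_id⟩
  have hM' : HasDerivWithinAt (fun τ => (fun i j => M τ i j : ι → ι → ℝ))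
      (fun i j => (A * M t) i j) s t :=
    hasDerivWithinAt_pi.2 fun i => hasDerivWithinAt_pi.2 fun j => hM i j
  have h := (D.hasFDerivAt (x := fun i j => M t i j)).comp_hasDerivWithinAt t hM'
  refine h.congr_deriv ?_
  rw [ContinuousMultilinearMap.linearDeriv_apply, Matrix.trace, Finset.sum_mul]
  refine Finset.sum_congr rfl fun i _ => ?_
  have hrow : (fun j => (A * M t) i j) = ∑ k, A i k • M t k := by
    ext j
    simp [Matrix.mul_apply]
  have := Matrix.det_updateRow_sum (M t) i (A i)
  rw [← hrow] at this
  exact this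

/-- **Jacobi's formula** along a solution of the operator equation `M' = A ∘ M`. -/
theorem ContinuousLinearMap.hasDerivWithinAt_det {E : Type*} [NormedAddCommGroup E]
    [NormedSpace ℝ E] [FiniteDimensional ℝ E] {M : ℝ → E →L[ℝ] E} {A : E →L[ℝ] E} {s : Set ℝ}
    {t : ℝ} (hM : HasDerivWithinAt M (A ∘L M t) s t) :
    HasDerivWithinAt (fun τ => (M τ).det) (LinearMap.trace ℝ E A * (M t).det) s t := by
  let b := Module.finBasis ℝ E
  have key := Matrix.hasDerivWithinAt_det (M := fun τ => LinearMap.toMatrix b b (M τ))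
    (A := LinearMap.toMatrix b b A) (s := s) (t := t) fun i j => by
      have h := (LinearMap.toContinuousLinearMap (b.coord i)).hasFDerivAt.comp_hasDerivWithinAt t
        (hM.clm_apply (hasDerivWithinAt_const t s (b j)))
      rw [← LinearMap.toMatrix_comp]
      simpa [LinearMap.toMatrix_apply, Function.comp_def] using h
  simpa only [ContinuousLinearMap.det, LinearMap.det_toMatrix,
    ← LinearMap.trace_eq_matrix_trace] using key

open Set Metric in
/-- If `Z` is Lipschitz on a ball containing the unit neighbourhood of the orbit of `x` up to time
`T`, then orbits starting close enough to `x` separate from it at most exponentially. -/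
theorem norm_flow_sub_le {E : Type*} [NormedAddCommGroup E] [NormedSpace ℝ E]
    {Z : E → E} {φ : ℝ → E → E} (hφ0 : ∀ x, φ 0 x = x)
    (hφ : ∀ x, ∀ t ≥ (0 : ℝ), HasDerivWithinAt (fun s => φ s x) (Z (φ t x)) (Ici 0) t)
    {x : E} {T L R : ℝ} (hR : ∀ t ∈ Icc 0 T, ‖φ t x‖ ≤ R)
    (hL : ∀ p ∈ closedBall (0 : E) (R + 1), ∀ q ∈ closedBall (0 : E) (R + 1),
      ‖Z q - Z p‖ ≤ L * ‖q - p‖) (hL0 : 0 ≤ L)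
    {y : E} (hy : ‖y - x‖ * Real.exp ((L + 1) * T) ≤ 1) :
    ∀ t ∈ Icc 0 T, ‖φ t y - φ t x‖ ≤ ‖y - x‖ * Real.exp ((L + 1) * T) := by
  rcases eq_or_ne y x with rfl | hne
  · simp
  have hpos : 0 < ‖y - x‖ := norm_pos_iff.2 (sub_ne_zero.2 hne)
  have hderiv (z : E) (t : ℝ) (ht : 0 ≤ t) :
      HasDerivWithinAt (fun s => φ s z) (Z (φ t z)) (Ici t) t :=
    (hφ z t ht).mono (Ici_subset_Ici.2 ht)
  have hcont (z : E) : ContinuousOn (fun s => φ s z) (Icc 0 T) := fun t ht =>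
    (hφ z t ht.1).continuousWithinAt.mono Icc_subset_Ici_self
  have hexp (t : ℝ) (ht : t ≤ T) :
      ‖y - x‖ * Real.exp ((L + 1) * t) ≤ ‖y - x‖ * Real.exp ((L + 1) * T) := by
    gcongr
  have hB (t : ℝ) : HasDerivAt (fun s => ‖y - x‖ * Real.exp ((L + 1) * s))
      ((L + 1) * (‖y - x‖ * Real.exp ((L + 1) * t))) t := by
    have := (((hasDerivAt_id t).const_mul (L + 1)).exp).const_mul ‖y - x‖
    refine this.congr_deriv ?_
    simp only [id]
    ring
  intro t ht
  refine (image_norm_le_of_norm_deriv_right_lt_deriv_boundary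
    (f := fun s => φ s y - φ s x) (f' := fun s => Z (φ s y) - Z (φ s x))
    ((hcont y).sub (hcont x)) (fun s hs => (hderiv y s hs.1).sub (hderiv x s hs.1))
    (by simp [hφ0]) hB (fun s hs heq => ?_) ht).trans (hexp t ht.2)
  have hx : ‖φ s x‖ ≤ R := hR s (Ico_subset_Icc_self hs)
  have hle : ‖φ s y - φ s x‖ ≤ 1 := heq.le.trans ((hexp s hs.2.le).trans hy)
  have hyR : ‖φ s y‖ ≤ R + 1 := by
    have := norm_le_insert' (φ s y) (φ s x)
    linarith
  calc ‖Z (φ s y) - Z (φ s x)‖ ≤ L * ‖φ s y - φ s x‖ :=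
        hL _ (mem_closedBall_zero_iff.2 (by linarith)) _ (mem_closedBall_zero_iff.2 hyR)
    _ < (L + 1) * (‖y - x‖ * Real.exp ((L + 1) * s)) := by
      rw [heq]
      gcongr
      linarith

open Set Metric in
/-- The flow of a `C¹` vector field is differentiable in the initial point, and its derivative
solves the linearised equation along the orbit. -/
theorem exists_hasFDerivAt_flow {E : Type*} [NormedAddCommGroup E] [NormedSpace ℝ E]
    [FiniteDimensional ℝ E] {Z : E → E} (hZ : ContDiff ℝ 1 Z) {φ : ℝ → E → E}
    (hφ0 : ∀ x, φ 0 x = x)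
    (hφ : ∀ x, ∀ t ≥ (0 : ℝ), HasDerivWithinAt (fun s => φ s x) (Z (φ t x)) (Ici 0) t)
    (x : E) {T : ℝ} (hT : 0 ≤ T) :
    ∃ M : ℝ → E →L[ℝ] E, M 0 = ContinuousLinearMap.id ℝ E ∧
      (∀ t ∈ Icc 0 T, HasDerivWithinAt M (fderiv ℝ Z (φ t x) ∘L M t) (Icc 0 T) t) ∧
      HasFDerivAt (φ T) (M T) x := by
  have : ProperSpace E := FiniteDimensional.proper_real E
  have hdiff : Differentiable ℝ Z := hZ.differentiable one_ne_zero
  have hZ' : Continuous (fderiv ℝ Z) := hZ.continuous_fderiv one_ne_zero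
  have hderiv (z : E) (t : ℝ) (ht : 0 ≤ t) :
      HasDerivWithinAt (fun s => φ s z) (Z (φ t z)) (Ici t) t :=
    (hφ z t ht).mono (Ici_subset_Ici.2 ht)
  have hcont (z : E) : ContinuousOn (fun s => φ s z) (Icc 0 T) := fun t ht =>
    (hφ z t ht.1).continuousWithinAt.mono Icc_subset_Ici_self
  obtain ⟨M, hM0, hM⟩ := exists_hasDerivWithinAt_linear hT
    (B := fun t => ContinuousLinearMap.compL ℝ E E E (fderiv ℝ Z (φ t x)))
    ((ContinuousLinearMap.compL ℝ E E E).continuous.comp_continuousOn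
      (hZ'.comp_continuousOn (hcont x))) (ContinuousLinearMap.id ℝ E)
  simp only [ContinuousLinearMap.compL_apply] at hM
  refine ⟨M, hM0, hM, ?_⟩
  obtain ⟨R, hR⟩ := isCompact_Icc.exists_bound_of_continuousOn (hcont x)
  obtain ⟨L₀, hL₀⟩ := (isCompact_closedBall (0 : E) (R + 1)).exists_bound_of_continuousOn
    hZ'.continuousOn
  set L := max L₀ 1
  have hL1 : 1 ≤ L := le_max_right _ _
  have hfL (p : E) (hp : p ∈ closedBall (0 : E) (R + 1)) : ‖fderiv ℝ Z p‖ ≤ L :=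
    (hL₀ p hp).trans (le_max_left _ _)
  have hLip : ∀ p ∈ closedBall (0 : E) (R + 1), ∀ q ∈ closedBall (0 : E) (R + 1),
      ‖Z q - Z p‖ ≤ L * ‖q - p‖ := fun p hp q hq =>
    (convex_closedBall _ _).norm_image_sub_le_of_norm_fderiv_le (fun z _ => hdiff z) hfL hp hq
  set c := Real.exp ((L + 1) * T)
  have hc : 0 < c := Real.exp_pos _
  have hunif := (isCompact_closedBall (0 : E) (R + 1)).uniformContinuousOn_of_continuous
    hZ'.continuousOn
  rw [Metric.uniformContinuousOn_iff] at hunif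
  rw [hasFDerivAt_iff_isLittleO, Asymptotics.isLittleO_iff]
  intro ε hε
  set η := ε / (c * Real.exp (L * T))
  have hη : 0 < η := by positivity
  obtain ⟨δ, hδ, hδη⟩ := hunif η hη
  have hnhds : ∀ᶠ y in nhds x, ‖y - x‖ < min 1 δ / c := by
    have := Metric.ball_mem_nhds x (ε := min 1 δ / c) (by positivity)
    filter_upwards [this] with y hy
    rwa [← dist_eq_norm]
  filter_upwards [hnhds] with y hy
  rw [lt_div_iff₀ hc, lt_min_iff] at hy
  have hD := norm_flow_sub_le hφ0 hφ hR hLip (by linarith) hy.1.le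
  have htaylor (t : ℝ) (ht : t ∈ Icc 0 T) :
      ‖Z (φ t y) - Z (φ t x) - fderiv ℝ Z (φ t x) (φ t y - φ t x)‖ ≤ η * (‖y - x‖ * c) := by
    have hx : ‖φ t x‖ ≤ R := hR t ht
    have hyx : ‖φ t y - φ t x‖ ≤ ‖y - x‖ * c := hD t ht
    have hxmem : φ t x ∈ closedBall (0 : E) (R + 1) := mem_closedBall_zero_iff.2 (by linarith)
    have hymem : φ t y ∈ closedBall (0 : E) (R + 1) := mem_closedBall_zero_iff.2 (by
      have := norm_le_insert' (φ t y) (φ t x)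
      linarith)
    refine (Convex.norm_image_sub_le_of_norm_fderiv_le' (𝕜 := ℝ) (C := η)
      (s := ball (φ t x) δ ∩ closedBall 0 (R + 1)) (fun z _ => hdiff z) (fun z hz => ?_)
      ((convex_ball _ _).inter (convex_closedBall _ _)) ⟨mem_ball_self hδ, hxmem⟩
      ⟨?_, hymem⟩).trans (by gcongr)
    · rw [← dist_eq_norm]
      exact (hδη z hz.2 _ hxmem hz.1).le
    · rw [mem_ball, dist_eq_norm]
      exact hyx.trans_lt hy.2
  have hMc : ContinuousOn M (Icc 0 T) := fun t ht => (hM t ht).continuousWithinAt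
  have hgron := norm_le_gronwallBound_of_norm_deriv_right_le
    (f := fun t => φ t y - φ t x - M t (y - x))
    (f' := fun t => Z (φ t y) - Z (φ t x) - (fderiv ℝ Z (φ t x) ∘L M t) (y - x))
    (δ := 0) (K := L) (ε := η * (‖y - x‖ * c)) (a := 0) (b := T)
    (((hcont y).sub (hcont x)).sub (hMc.clm_apply continuousOn_const))
    (fun t ht => ((hderiv y t ht.1).sub (hderiv x t ht.1)).sub (by
      simpa using ((hM t (Ico_subset_Icc_self ht)).Ici_of_Icc ht).clm_apply
        (hasDerivWithinAt_const t (Ici t) (y - x))))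
    (by simp [hφ0, hM0])
    (fun t ht => by
      have ht' := Ico_subset_Icc_self ht
      have hx : ‖φ t x‖ ≤ R := hR t ht'
      have hsplit : Z (φ t y) - Z (φ t x) - (fderiv ℝ Z (φ t x) ∘L M t) (y - x)
          = fderiv ℝ Z (φ t x) (φ t y - φ t x - M t (y - x))
            + (Z (φ t y) - Z (φ t x) - fderiv ℝ Z (φ t x) (φ t y - φ t x)) := by
        simp only [ContinuousLinearMap.comp_apply, map_sub]
        abel
      rw [hsplit]
      exact norm_add_le_of_le ((fderiv ℝ Z (φ t x)).le_of_opNorm_le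
        (hfL _ (mem_closedBall_zero_iff.2 (by linarith))) _) (htaylor t ht')) T ⟨hT, le_rfl⟩
  refine hgron.trans ?_
  rw [gronwallBound_of_K_ne_0 (by positivity)]
  simp only [zero_mul, zero_add, sub_zero]
  calc η * (‖y - x‖ * c) / L * (Real.exp (L * T) - 1)
      ≤ η * (‖y - x‖ * c) * Real.exp (L * T) := by
        gcongr
        · exact sub_nonneg.2 (Real.one_le_exp (by positivity))
        · exact div_le_self (by positivity) hL1
        · linarith
    _ = ε * ‖y - x‖ := by
      simp only [η]
      field_simp

open Set in
/-- Liouville's formula for the flow of a `C¹` vector field. -/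
theorem exists_hasFDerivAt_flow_det {E : Type*} [NormedAddCommGroup E] [NormedSpace ℝ E]
    [FiniteDimensional ℝ E] {Z : E → E} (hZ : ContDiff ℝ 1 Z) {φ : ℝ → E → E}
    (hφ0 : ∀ x, φ 0 x = x)
    (hφ : ∀ x, ∀ t ≥ (0 : ℝ), HasDerivWithinAt (fun s => φ s x) (Z (φ t x)) (Ici 0) t)
    (x : E) {T : ℝ} (hT : 0 ≤ T) :
    ∃ D : E →L[ℝ] E, HasFDerivAt (φ T) D x ∧
      D.det = Real.exp (∫ s in (0 : ℝ)..T, LinearMap.trace ℝ E (fderiv ℝ Z (φ s x))) := by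
  obtain ⟨M, hM0, hM, hMT⟩ := exists_hasFDerivAt_flow hZ hφ0 hφ x hT
  refine ⟨M T, hMT, ?_⟩
  let a : ℝ → ℝ := fun s => LinearMap.trace ℝ E (fderiv ℝ Z (φ (max s 0) x))
  have ha : Continuous a := by
    have hγ : Continuous fun s => φ (max s 0) x := by
      have : ContinuousOn (fun s => φ s x) (Ici 0) := fun t ht => (hφ x t ht).continuousWithinAt
      exact this.comp_continuous (by fun_prop) fun s => mem_Ici.2 (le_max_right _ _)
    have htr : Continuous fun A : E →L[ℝ] E => LinearMap.trace ℝ E A :=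
      LinearMap.continuous_of_finiteDimensional
        ((LinearMap.trace ℝ E) ∘ₗ ContinuousLinearMap.coeLM ℝ)
    exact htr.comp ((hZ.continuous_fderiv one_ne_zero).comp hγ)
  have hint : ∫ s in (0 : ℝ)..T, LinearMap.trace ℝ E (fderiv ℝ Z (φ s x))
      = ∫ s in (0 : ℝ)..T, a s := by
    refine intervalIntegral.integral_congr fun s hs => ?_
    rw [uIcc_of_le hT] at hs
    simp only [a, max_eq_left hs.1]
  have hconst := constant_of_has_deriv_right_zero (a := 0) (b := T)
    (f := fun t => (M t).det * Real.exp (-∫ s in (0 : ℝ)..t, a s)) ?_ ?_ T ⟨hT, le_rfl⟩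
  · simp only [hM0, intervalIntegral.integral_same, neg_zero, Real.exp_zero, mul_one,
      ContinuousLinearMap.det, ContinuousLinearMap.coe_id, LinearMap.det_id, Real.exp_neg]
      at hconst
    rw [hint]
    exact (mul_inv_eq_one₀ (Real.exp_ne_zero _)).1 hconst
  · have hdet : ContinuousOn (fun t => (M t).det) (Icc 0 T) := fun t ht =>
      (ContinuousLinearMap.hasDerivWithinAt_det (hM t ht)).continuousWithinAt
    refine hdet.mul (Continuous.continuousOn ?_)
    exact Real.continuous_exp.comp
      (intervalIntegral.continuous_primitive (fun _ _ => ha.intervalIntegrable _ _) 0).neg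
  · intro t ht
    have hdet := (ContinuousLinearMap.hasDerivWithinAt_det
      (hM t (Ico_subset_Icc_self ht))).Ici_of_Icc ht
    have hexp := (intervalIntegral.integral_hasDerivAt_right (ha.intervalIntegrable 0 t)
      (ha.stronglyMeasurableAtFilter _ _) ha.continuousAt).neg.exp.hasDerivWithinAt (s := Ici t)
    refine (hdet.mul hexp).congr_deriv ?_
    simp only [a, max_eq_left ht.1]
    ring

open Set Metric in
/-- The time-`T` map of the flow of a `C¹` vector field is injective. -/
theorem injective_flow {E : Type*} [NormedAddCommGroup E] [NormedSpace ℝ E]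
    [FiniteDimensional ℝ E] {Z : E → E} (hZ : ContDiff ℝ 1 Z) {φ : ℝ → E → E}
    (hφ0 : ∀ x, φ 0 x = x)
    (hφ : ∀ x, ∀ t ≥ (0 : ℝ), HasDerivWithinAt (fun s => φ s x) (Z (φ t x)) (Ici 0) t)
    {T : ℝ} (hT : 0 ≤ T) : Function.Injective (φ T) := by
  have : ProperSpace E := FiniteDimensional.proper_real E
  intro x y hxy
  have hcont (z : E) : ContinuousOn (fun s => φ s z) (Icc 0 T) := fun t ht =>
    (hφ z t ht.1).continuousWithinAt.mono Icc_subset_Ici_self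
  have hderiv (z : E) (t : ℝ) (ht : t ∈ Ioc 0 T) :
      HasDerivWithinAt (fun s => φ s z) (Z (φ t z)) (Iic t) t :=
    ((hφ z t ht.1.le).hasDerivAt (Ici_mem_nhds ht.1)).hasDerivWithinAt
  obtain ⟨Rx, hRx⟩ := isCompact_Icc.exists_bound_of_continuousOn (hcont x)
  obtain ⟨Ry, hRy⟩ := isCompact_Icc.exists_bound_of_continuousOn (hcont y)
  obtain ⟨L, hL⟩ := hZ.contDiffOn.exists_lipschitzOnWith one_ne_zero
    (convex_closedBall (0 : E) (max Rx Ry)) (isCompact_closedBall _ _)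
  have h := ODE_solution_unique_of_mem_Icc_left (v := fun _ => Z)
    (s := fun _ => closedBall (0 : E) (max Rx Ry)) (fun _ _ => hL) (hcont x) (hderiv x)
    (fun t ht => mem_closedBall_zero_iff.2
      ((hRx t (Ioc_subset_Icc_self ht)).trans (le_max_left _ _)))
    (hcont y) (hderiv y)
    (fun t ht => mem_closedBall_zero_iff.2
      ((hRy t (Ioc_subset_Icc_self ht)).trans (le_max_right _ _))) hxy (left_mem_Icc.2 hT)
  simpa [hφ0] using h

/-- The divergence is the trace of the derivative. -/
theorem dvg_eq_trace {n : ℕ} {Z : EuclideanSpace ℝ (Fin n) → EuclideanSpace ℝ (Fin n)}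
    {y : EuclideanSpace ℝ (Fin n)} (hZ : DifferentiableAt ℝ Z y) :
    dvg Z y = LinearMap.trace ℝ (EuclideanSpace ℝ (Fin n)) (fderiv ℝ Z y) := by
  rw [LinearMap.trace_eq_matrix_trace ℝ (EuclideanSpace.basisFun (Fin n) ℝ).toBasis, dvg,
    Matrix.trace]
  refine Finset.sum_congr rfl fun i _ => ?_
  have h : HasFDerivAt (fun x => Z x i) (EuclideanSpace.proj i ∘L fderiv ℝ Z y) y :=
    (EuclideanSpace.proj (𝕜 := ℝ) i).hasFDerivAt.comp y hZ.hasFDerivAt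
  rw [h.fderiv]
  simp [LinearMap.toMatrix_apply]

/-- divergence bound `|div Z| ≤ K‖Z‖` along orbits of finite length `≤ C`
forces the lower volume bound `vol(φₜ(S)) ≥ e^{−KC} vol(S)`; in particular if
`vol(φₜ(S)) → 0` then `vol(S) = 0`. -/
theorem stmt4 (n : ℕ) (Z : EuclideanSpace ℝ (Fin n) → EuclideanSpace ℝ (Fin n))
    (hZ : ContDiff ℝ 1 Z)
    (φ : ℝ → EuclideanSpace ℝ (Fin n) → EuclideanSpace ℝ (Fin n))
    (hφ0 : ∀ x, φ 0 x = x)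
    (hφ : ∀ x, ∀ t ≥ (0:ℝ),
      HasDerivWithinAt (fun s => φ s x) (Z (φ t x)) (Set.Ici 0) t)
    (S : Set (EuclideanSpace ℝ (Fin n))) (hS : MeasurableSet S) (hSfin : volume S < ⊤)
    (K C : ℝ) (hK : 0 < K) (hC : 0 < C)
    (hdiv : ∀ x ∈ S, ∀ s ≥ (0:ℝ), |dvg Z (φ s x)| ≤ K * ‖Z (φ s x)‖)
    (hlen : ∀ x ∈ S, ∫⁻ s in Set.Ioi (0:ℝ), ENNReal.ofReal ‖Z (φ s x)‖ ≤ ENNReal.ofReal C) :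
    (∀ t ≥ (0:ℝ),
        ENNReal.ofReal (Real.exp (-(K * C))) * volume S ≤ volume (φ t '' S))
    ∧ (Filter.Tendsto (fun t => volume (φ t '' S)) Filter.atTop (nhds 0) →
        volume S = 0) := by
  have hbound : ∀ t ≥ (0 : ℝ),
      ENNReal.ofReal (Real.exp (-(K * C))) * volume S ≤ volume (φ t '' S) := by
    intro t ht
    choose D hD hdet using fun x => exists_hasFDerivAt_flow_det hZ hφ0 hφ x ht
    rw [← lintegral_abs_det_fderiv_eq_addHaar_image volume hS
      (fun x _ => (hD x).hasFDerivWithinAt) (injective_flow hZ hφ0 hφ ht).injOn,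
      ← setLIntegral_const]
    refine setLIntegral_mono' hS fun x hx => ENNReal.ofReal_le_ofReal ?_
    rw [hdet, abs_of_pos (Real.exp_pos _), Real.exp_le_exp]
    have hγ : ContinuousOn (fun s => ‖Z (φ s x)‖) (Set.Ici 0) :=
      (hZ.continuous.comp_continuousOn fun s hs => (hφ x s hs).continuousWithinAt).norm
    have hlength : ∫ s in (0 : ℝ)..t, ‖Z (φ s x)‖ ≤ C := by
      rw [intervalIntegral.integral_of_le ht, integral_eq_lintegral_of_nonneg_ae
        (Filter.Eventually.of_forall fun _ => norm_nonneg _)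
        ((hγ.mono fun s hs => hs.1.le).aestronglyMeasurable measurableSet_Ioc)]
      refine ENNReal.toReal_le_of_le_ofReal hC.le ((lintegral_mono_set ?_).trans (hlen x hx))
      exact Set.Ioc_subset_Ioi_self
    have hspeed : IntervalIntegrable (fun s => K * ‖Z (φ s x)‖) volume 0 t := by
      refine ((hγ.mono fun s hs => ?_).intervalIntegrable).const_mul K
      rw [Set.uIcc_of_le ht] at hs
      exact hs.1
    have hnorm := intervalIntegral.norm_integral_le_of_norm_le (μ := volume) ht
      (f := fun s => LinearMap.trace ℝ (EuclideanSpace ℝ (Fin n)) (fderiv ℝ Z (φ s x)))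
      (Filter.Eventually.of_forall fun s hs => by
        rw [← dvg_eq_trace (hZ.differentiable one_ne_zero _)]
        exact hdiv x hx s hs.1.le) hspeed
    rw [intervalIntegral.integral_const_mul, Real.norm_eq_abs] at hnorm
    have hKC := mul_le_mul_of_nonneg_left hlength hK.le
    exact neg_le_of_abs_le (hnorm.trans hKC)
  refine ⟨hbound, fun hlim => ?_⟩
  have hle := ge_of_tendsto hlim
    ((Filter.eventually_ge_atTop 0).mono fun t ht => hbound t ht)
  exact (mul_eq_zero.1 (nonpos_iff_eq_zero.1 hle)).resolve_left
    (ENNReal.ofReal_pos.2 (Real.exp_pos _)).ne'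
end

section
/- Let K > 0. There do not exist sequences (z_k)_{k∈ℕ} and (ℓ_k)_{k∈ℕ} of positive real numbers satisfying, for every k ∈ ℕ: (a) z_{k+1} − z_k ≥ −(2/3)·z_k^{9/2}·ℓ_k; (b) z_{k+1} − z_k ≤ −z_{k+1}^{11/2}/35; (c) z_k ≤ K·ℓ_k; (d) ℓ_k ≤ K·(z_k + 2·z_k^{3/2}); together with Σ_{k∈ℕ} ℓ_k < ∞. Equivalently, for any sequences of positive reals satisfying (a)–(d), the series Σ_k ℓ_k diverges. -/
open Filter Topology in
/-- no sequences of positive reals can satisfy the estimates (a)–(d)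
and have `Σ ℓₖ < ∞`; equivalently `Σ ℓₖ` diverges. -/
theorem stmt5 (K : ℝ) (hK : 0 < K) (z ℓ : ℕ → ℝ)
    (hz : ∀ k, 0 < z k) (hl : ∀ k, 0 < ℓ k)
    (ha : ∀ k, z (k + 1) - z k ≥ -(2 / 3) * z k ^ ((9 : ℝ) / 2) * ℓ k)
    (hb : ∀ k, z (k + 1) - z k ≤ -(z (k + 1) ^ ((11 : ℝ) / 2)) / 35)
    (hc : ∀ k, z k ≤ K * ℓ k)
    (hd : ∀ k, ℓ k ≤ K * (z k + 2 * z k ^ ((3 : ℝ) / 2))) :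
    ¬ Summable ℓ := by
  intro hs
  have hz0 : Tendsto z atTop (𝓝 0) :=
    squeeze_zero (fun k => (hz k).le) hc (by simpa using hs.tendsto_atTop_zero.const_mul K)
  have hanti : Antitone z := antitone_nat_of_succ_le fun k => by
    have := Real.rpow_pos_of_pos (hz (k + 1)) ((11 : ℝ) / 2)
    linarith [hb k]
  obtain ⟨N, hN1, hNs⟩ := ((hz0.eventually_lt_const one_pos).and
    ((tendsto_sum_nat_add ℓ).eventually_lt_const one_pos)).exists
  have hstep (k : ℕ) (hk : N ≤ k) : z k - 2 / 3 * z N * ℓ k ≤ z (k + 1) := by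
    have hkN := hanti hk
    have hpow : z k ^ ((9 : ℝ) / 2) ≤ z k := by
      simpa using Real.rpow_le_rpow_of_exponent_ge (hz k) (hkN.trans hN1.le)
        (by norm_num : (1 : ℝ) ≤ 9 / 2)
    have := mul_le_mul_of_nonneg_right (hpow.trans hkN) (hl k).le
    linarith [ha k]
  have hsum (m : ℕ) : z N - 2 / 3 * z N * ∑ i ∈ Finset.range m, ℓ (i + N) ≤ z (m + N) := by
    induction m with
    | zero => simp
    | succ m ih =>
      rw [Finset.sum_range_succ, add_right_comm]
      linarith [hstep (m + N) (Nat.le_add_left N m)]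
  have hlow (m : ℕ) : z N / 3 ≤ z (m + N) := by
    have htail := ((summable_nat_add_iff N).2 hs).sum_le_tsum (Finset.range m)
      fun i _ => (hl (i + N)).le
    have := mul_le_mul_of_nonneg_left (htail.trans hNs.le) (hz N).le
    linarith [hsum m]
  have := ge_of_tendsto' ((tendsto_add_atTop_iff_nat N).2 hz0) hlow
  linarith [hz N]
end

section
/- Let U ⊆ ℝⁿ be open, h : U → ℝ of class C², and Z : U → ℝⁿ of class C¹ with ⟨Z(x), ∇h(x)⟩ = 0 for every x ∈ U. Then at every point x ∈ U with ∇h(x) ≠ 0, setting N = ∇h(x)/‖∇h(x)‖, one has ⟨DZ(x)(N), N⟩ = −⟨Z(x), ∇(‖∇h‖²)(x)⟩ / (2‖∇h(x)‖²). Consequently, at points of the hypersurface {h = 0} where ∇h ≠ 0, the divergence of the restriction of Z to the hypersurface with respect to the induced Euclidean metric, which equals div Z(x) − ⟨DZ(x)(N), N⟩, is given by div Z(x) + ⟨Z(x), ∇(‖∇h‖²)(x)⟩ / (2‖∇h(x)‖²). -/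
open RealInnerProductSpace

section Gradient

variable {E : Type*} [NormedAddCommGroup E] [InnerProductSpace ℝ E] [CompleteSpace E]

theorem ContDiffAt.differentiableAt_gradient {f : E → ℝ} {x : E} (hf : ContDiffAt ℝ 2 f x) :
    DifferentiableAt ℝ (gradient f) x :=
  (InnerProductSpace.toDual ℝ E).symm.differentiable.differentiableAt.comp x
    ((hf.fderiv_right (m := 1) (by norm_num)).differentiableAt (by norm_num))

theorem ContDiffAt.inner_fderiv_gradient {f : E → ℝ} {x : E} (hf : ContDiffAt ℝ 2 f x) (v w : E) :
    ⟪w, fderiv ℝ (gradient f) x v⟫ = fderiv ℝ (fderiv ℝ f) x v w := by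
  have hd : DifferentiableAt ℝ (fderiv ℝ f) x :=
    (hf.fderiv_right (m := 1) (by norm_num)).differentiableAt (by norm_num)
  have h₁ := (hasFDerivAt_const w x).inner ℝ hf.differentiableAt_gradient.hasFDerivAt
  have h₂ : HasFDerivAt (fun y => ⟪w, gradient f y⟫)
      ((fderiv ℝ (fderiv ℝ f) x).flip w) x := by
    simp only [inner_gradient_right, conj_trivial]
    simpa using hd.hasFDerivAt.clm_apply (hasFDerivAt_const w x)
  simpa using DFunLike.congr_fun (h₁.unique h₂) v

/-- The Hessian, seen as the derivative of the gradient, is self-adjoint. -/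
theorem ContDiffAt.inner_fderiv_gradient_comm {f : E → ℝ} {x : E} (hf : ContDiffAt ℝ 2 f x)
    (v w : E) : ⟪w, fderiv ℝ (gradient f) x v⟫ = ⟪v, fderiv ℝ (gradient f) x w⟫ := by
  rw [hf.inner_fderiv_gradient, hf.inner_fderiv_gradient]
  exact (hf.isSymmSndFDerivAt (by simp)).eq v w

theorem inner_gradient_norm_gradient_sq {f : E → ℝ} {Z : E → E} {x : E}
    (hf : ContDiffAt ℝ 2 f x) (hZ : DifferentiableAt ℝ Z x)
    (htan : ∀ᶠ y in nhds x, ⟪Z y, gradient f y⟫ = 0) :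
    ⟪Z x, gradient (fun y => ‖gradient f y‖ ^ 2) x⟫
      = -(2 * ⟪fderiv ℝ Z x (gradient f x), gradient f x⟫) := by
  have hG := hf.differentiableAt_gradient.hasFDerivAt
  have h₁ : ⟪Z x, fderiv ℝ (gradient f) x (gradient f x)⟫
      + ⟪fderiv ℝ Z x (gradient f x), gradient f x⟫ = 0 := by
    have h₀ : HasFDerivAt (fun y => ⟪Z y, gradient f y⟫) (0 : E →L[ℝ] ℝ) x :=
      (hasFDerivAt_const (0 : ℝ) x).congr_of_eventuallyEq htan
    simpa using DFunLike.congr_fun ((hZ.hasFDerivAt.inner ℝ hG).unique h₀) (gradient f x)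
  rw [inner_gradient_right, conj_trivial, hG.norm_sq.fderiv]
  have h₂ := hf.inner_fderiv_gradient_comm (Z x) (gradient f x)
  simp at h₁ h₂ ⊢
  linarith

end Gradient

/-- for a vector field `Z` tangent to the level sets of `h`, at a point where
`∇h ≠ 0`, one has `⟨DZ(N), N⟩ = −⟨Z, ∇(‖∇h‖²)⟩/(2‖∇h‖²)` with `N = ∇h/‖∇h‖`; consequently
on `{h = 0}` the tangential divergence `div Z − ⟨DZ(N), N⟩` equals
`div Z + ⟨Z, ∇(‖∇h‖²)⟩/(2‖∇h‖²)`. -/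
theorem stmt6 (n : ℕ) (U : Set (EuclideanSpace ℝ (Fin n))) (hU : IsOpen U)
    (h : EuclideanSpace ℝ (Fin n) → ℝ) (hh : ContDiffOn ℝ 2 h U)
    (Z : EuclideanSpace ℝ (Fin n) → EuclideanSpace ℝ (Fin n)) (hZ : ContDiffOn ℝ 1 Z U)
    (htan : ∀ x ∈ U, ⟪Z x, gradient h x⟫ = 0)
    (x : EuclideanSpace ℝ (Fin n)) (hx : x ∈ U) (hgrad : gradient h x ≠ 0) :
    ⟪fderiv ℝ Z x (‖gradient h x‖⁻¹ • gradient h x), ‖gradient h x‖⁻¹ • gradient h x⟫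
        = -⟪Z x, gradient (fun y => ‖gradient h y‖ ^ 2) x⟫ / (2 * ‖gradient h x‖ ^ 2)
    ∧ (h x = 0 →
        dvg Z x
            - ⟪fderiv ℝ Z x (‖gradient h x‖⁻¹ • gradient h x),
                ‖gradient h x‖⁻¹ • gradient h x⟫
          = dvg Z x
            + ⟪Z x, gradient (fun y => ‖gradient h y‖ ^ 2) x⟫ / (2 * ‖gradient h x‖ ^ 2)) := by
  have hxU := hU.mem_nhds hx
  have key := inner_gradient_norm_gradient_sq (hh.contDiffAt hxU)
    ((hZ.contDiffAt hxU).differentiableAt one_ne_zero)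
    (Filter.eventually_of_mem hxU htan)
  have hN : ⟪fderiv ℝ Z x (‖gradient h x‖⁻¹ • gradient h x), ‖gradient h x‖⁻¹ • gradient h x⟫
      = -⟪Z x, gradient (fun y => ‖gradient h y‖ ^ 2) x⟫ / (2 * ‖gradient h x‖ ^ 2) := by
    have hne : ‖gradient h x‖ ≠ 0 := norm_ne_zero_iff.mpr hgrad
    rw [key, map_smul, real_inner_smul_left, real_inner_smul_right]
    field_simp
  refine ⟨hN, fun _ => ?_⟩
  rw [hN]
  ring
end

section
/- Let T ∈ (0, ∞], x̄ < 0, and let (x, y) : [0, T) → ℝ² be a C¹ solution of the planar system ẋ = −2xy, ẏ = −(3x³ + 2y²) with x(0) = x̄ and y(0) = 0. Then for every t ∈ (0, T): x(t) < 0, y(t) > 0, and ẋ(t) > 0. -/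
/-- A function continuous on a segment has an antiderivative there. -/
theorem ContinuousOn.exists_hasDerivAt_Icc {f : ℝ → ℝ} {a b : ℝ} (hab : a ≤ b)
    (hf : ContinuousOn f (Set.Icc a b)) :
    ∃ F : ℝ → ℝ, ∀ s ∈ Set.Icc a b, HasDerivAt F (f s) s := by
  have hg : Continuous (Set.IccExtend hab ((Set.Icc a b).domRestrict f)) :=
    hf.domRestrict.Icc_extend'
  refine ⟨fun s => ∫ u in a..s, Set.IccExtend hab ((Set.Icc a b).domRestrict f) u, fun s hs => ?_⟩
  have h := intervalIntegral.integral_hasDerivAt_right (hg.intervalIntegrable a s)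
    hg.stronglyMeasurable.stronglyMeasurableAtFilter hg.continuousAt
  rwa [Set.IccExtend_of_mem hab _ hs] at h

/-- Multiplication by the integrating factor `exp (2 Y)`. -/
theorem HasDerivWithinAt.mul_exp_two_mul {u Y : ℝ → ℝ} {u' y s : ℝ} {S : Set ℝ}
    (hu : HasDerivWithinAt u u' S s) (hY : HasDerivAt Y y s) :
    HasDerivWithinAt (fun r => u r * Real.exp (2 * Y r))
      ((u' + 2 * y * u s) * Real.exp (2 * Y s)) S s := by
  refine (hu.mul (hY.const_mul 2).exp.hasDerivWithinAt).congr_deriv ?_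
  ring


/-- a solution of `ẋ = −2xy`, `ẏ = −(3x³ + 2y²)` on `[0, T)` starting at
`(x̄, 0)` with `x̄ < 0` satisfies `x(t) < 0`, `y(t) > 0` and `ẋ(t) > 0` for all
`t ∈ (0, T)`. -/
theorem stmt9 (T : EReal) (hT : 0 < T) (xbar : ℝ) (hxbar : xbar < 0)
    (x y : ℝ → ℝ)
    (hx : ∀ t : ℝ, 0 ≤ t → (t : EReal) < T →
      HasDerivWithinAt x (-2 * x t * y t) {s : ℝ | 0 ≤ s ∧ (s : EReal) < T} t)
    (hy : ∀ t : ℝ, 0 ≤ t → (t : EReal) < T →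
      HasDerivWithinAt y (-(3 * (x t) ^ 3 + 2 * (y t) ^ 2))
        {s : ℝ | 0 ≤ s ∧ (s : EReal) < T} t)
    (hx0 : x 0 = xbar) (hy0 : y 0 = 0) :
    ∀ t : ℝ, 0 < t → (t : EReal) < T →
      x t < 0 ∧ 0 < y t ∧ 0 < -2 * x t * y t := by
  intro t ht htT
  have hsub : Set.Icc 0 t ⊆ {s : ℝ | 0 ≤ s ∧ (s : EReal) < T} := fun s hs =>
    ⟨hs.1, (EReal.coe_le_coe_iff.2 hs.2).trans_lt htT⟩
  have hx' : ∀ s ∈ Set.Icc 0 t,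
      HasDerivWithinAt x (-2 * x s * y s) (Set.Icc 0 t) s := fun s hs =>
    (hx s (hsub hs).1 (hsub hs).2).mono hsub
  have hy' : ∀ s ∈ Set.Icc 0 t,
      HasDerivWithinAt y (-(3 * (x s) ^ 3 + 2 * (y s) ^ 2)) (Set.Icc 0 t) s := fun s hs =>
    (hy s (hsub hs).1 (hsub hs).2).mono hsub
  have hyc : ContinuousOn y (Set.Icc 0 t) := fun s hs => (hy' s hs).continuousWithinAt
  obtain ⟨Y, hY⟩ := hyc.exists_hasDerivAt_Icc ht.le
  have hxY := fun s hs => (hx' s hs).mul_exp_two_mul (hY s hs)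
  have hyY := fun s hs => (hy' s hs).mul_exp_two_mul (hY s hs)
  have h0 : (0 : ℝ) ∈ Set.Icc 0 t := ⟨le_rfl, ht.le⟩
  have hxneg : ∀ s ∈ Set.Icc 0 t, x s < 0 := by
    have hanti : AntitoneOn (fun s => x s * Real.exp (2 * Y s)) (Set.Icc 0 t) := by
      refine antitoneOn_of_hasDerivWithinAt_nonpos (convex_Icc 0 t)
        (fun s hs => (hxY s hs).continuousWithinAt)
        (fun s hs => (hxY s (interior_subset hs)).mono interior_subset)
        fun s _ => le_of_eq ?_
      ring
    intro s hs
    have h := hanti h0 hs hs.1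
    simp only [hx0] at h
    exact neg_of_mul_neg_left
      (h.trans_lt (mul_neg_of_neg_of_pos hxbar (Real.exp_pos _))) (Real.exp_pos _).le
  have hxt := hxneg t ⟨ht.le, le_rfl⟩
  have hyt : 0 < y t := by
    have hmono : StrictMonoOn (fun s => y s * Real.exp (2 * Y s)) (Set.Icc 0 t) := by
      refine strictMonoOn_of_hasDerivWithinAt_pos (convex_Icc 0 t)
        (fun s hs => (hyY s hs).continuousWithinAt)
        (fun s hs => (hyY s (interior_subset hs)).mono interior_subset)
        fun s hs => mul_pos ?_ (Real.exp_pos _)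
      have h3 : x s ^ 3 < 0 := Odd.pow_neg (by decide) (hxneg s (interior_subset hs))
      linarith
    have h := hmono h0 ⟨ht.le, le_rfl⟩ ht
    simp only [hy0, zero_mul] at h
    exact pos_of_mul_pos_left h (Real.exp_pos _).le
  exact ⟨hxt, hyt, mul_pos (by linarith) hyt⟩
end

section
/- Let V ⊆ ℝ³ be open, let A¹, A² : V → ℝ be smooth, and define the vector fields X¹(x) = (1, 0, A¹(x)) and X²(x) = (0, 1, A²(x)). Let W : V → ℝ³ be a smooth vector field and let x ∈ V be a point at which A¹(x) = A²(x) = 0, ∂₁A^j(x) = ∂₂A^j(x) = 0 for j = 1, 2, and W₃(x) = 0 (W₃ denotes the third component of W). Then for each i ∈ {1, 2}, the third component of the Lie bracket [W, X^i] at x equals −∂ᵢW₃(x). -/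
/-- The derivative of a vector field in coordinates: its `k`-th component is the derivative
of the `k`-th coordinate function. -/
theorem fderiv_apply_coord {W : (Fin 3 → ℝ) → (Fin 3 → ℝ)} {x : Fin 3 → ℝ}
    (hW : DifferentiableAt ℝ W x) (k : Fin 3) (v : Fin 3 → ℝ) :
    fderiv ℝ W x v k = fderiv ℝ (fun y => W y k) x v := by
  rw [fderiv_apply hW k]
  rfl

/-- A differential whose first two partial derivatives vanish kills every vector with
vanishing third component. -/
theorem fderiv_eq_zero_of_pd_eq_zero {f : (Fin 3 → ℝ) → ℝ} {x v : Fin 3 → ℝ}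
    (h0 : pd 0 f x = 0) (h1 : pd 1 f x = 0) (hv : v 2 = 0) : fderiv ℝ f x v = 0 := by
  unfold pd at h0 h1
  have hv' : v = v 0 • Pi.single 0 1 + v 1 • Pi.single 1 1 := by
    ext j
    fin_cases j <;> simp [hv]
  rw [hv', map_add, map_smul, map_smul, h0, h1, smul_zero, smul_zero, add_zero]

/-- The third component of the bracket of `W` with the field `(a, b, f)`. -/
theorem bracket_third_component {f : (Fin 3 → ℝ) → ℝ} {W : (Fin 3 → ℝ) → (Fin 3 → ℝ)}
    {x : Fin 3 → ℝ} (hf : DifferentiableAt ℝ f x) (hW : DifferentiableAt ℝ W x)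
    (h0 : pd 0 f x = 0) (h1 : pd 1 f x = 0) (hW3 : W x 2 = 0) (a b : ℝ) :
    (fderiv ℝ (fun y => (![a, b, f y] : Fin 3 → ℝ)) x (W x) - fderiv ℝ W x ![a, b, f x]) 2
      = -(fderiv ℝ (fun y => W y 2) x ![a, b, f x]) := by
  have hX : DifferentiableAt ℝ (fun y => (![a, b, f y] : Fin 3 → ℝ)) x := by
    rw [differentiableAt_pi]
    intro i
    fin_cases i
    · exact differentiableAt_const a
    · exact differentiableAt_const b
    · exact hf
  have hz : fderiv ℝ (fun y => (![a, b, f y] : Fin 3 → ℝ) 2) x (W x) = 0 :=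
    fderiv_eq_zero_of_pd_eq_zero h0 h1 hW3
  rw [Pi.sub_apply, fderiv_apply_coord hX, fderiv_apply_coord hW, hz, zero_sub]

/-- at a point `x` where `A¹ = A² = 0`, `∂₁Aʲ = ∂₂Aʲ = 0` and `W₃ = 0`,
the third component of `[W, Xⁱ](x) = DXⁱ(x)(W(x)) − DW(x)(Xⁱ(x))` equals `−∂ᵢW₃(x)`,
for `X¹ = (1, 0, A¹)` and `X² = (0, 1, A²)`. -/
theorem stmt10 (V : Set (Fin 3 → ℝ)) (hV : IsOpen V)
    (A1 A2 : (Fin 3 → ℝ) → ℝ)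
    (hA1 : ContDiffOn ℝ (⊤ : ℕ∞) A1 V) (hA2 : ContDiffOn ℝ (⊤ : ℕ∞) A2 V)
    (W : (Fin 3 → ℝ) → (Fin 3 → ℝ)) (hW : ContDiffOn ℝ (⊤ : ℕ∞) W V)
    (x : Fin 3 → ℝ) (hx : x ∈ V)
    (hA1x : A1 x = 0) (hA2x : A2 x = 0)
    (hA1d1 : pd 0 A1 x = 0) (hA1d2 : pd 1 A1 x = 0)
    (hA2d1 : pd 0 A2 x = 0) (hA2d2 : pd 1 A2 x = 0)
    (hW3 : W x 2 = 0) :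
    (fderiv ℝ (fun y => (![1, 0, A1 y] : Fin 3 → ℝ)) x (W x)
        - fderiv ℝ W x ![1, 0, A1 x]) 2
      = -(pd 0 (fun y => W y 2) x)
    ∧ (fderiv ℝ (fun y => (![0, 1, A2 y] : Fin 3 → ℝ)) x (W x)
        - fderiv ℝ W x ![0, 1, A2 x]) 2
      = -(pd 1 (fun y => W y 2) x) := by
  have hn := hV.mem_nhds hx
  have ne : ((⊤ : ℕ∞) : WithTop ℕ∞) ≠ 0 := by simp
  have dW := (hW.contDiffAt hn).differentiableAt ne
  have e0 : (![1, 0, 0] : Fin 3 → ℝ) = Pi.single 0 1 := by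
    ext j; fin_cases j <;> simp
  have e1 : (![0, 1, 0] : Fin 3 → ℝ) = Pi.single 1 1 := by
    ext j; fin_cases j <;> simp
  constructor
  · rw [bracket_third_component ((hA1.contDiffAt hn).differentiableAt ne) dW hA1d1 hA1d2 hW3,
      hA1x, e0, pd]
  · rw [bracket_third_component ((hA2.contDiffAt hn).differentiableAt ne) dW hA2d1 hA2d2 hW3,
      hA2x, e1, pd]
end

section
/- Let Z = (A, B, C) : ℝ³ → ℝ³ be a C¹ vector field and let σ : ℝ³ → ℝ³ be the blow-down map σ(u, v, w) = (uw, vw, w). For w ≠ 0 define the pulled-back vector field Z*(u, v, w) = ( (A(σ(u,v,w)) − u·C(σ(u,v,w)))/w, (B(σ(u,v,w)) − v·C(σ(u,v,w)))/w, C(σ(u,v,w)) ), which is the unique vector field satisfying Dσ(p)(Z*(p)) = Z(σ(p)). Then for every p = (u, v, w) with w ≠ 0: div Z*(p) = (div Z)(σ(p)) − (2/w)·C(σ(p)). -/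
/-- The derivative of the blow-down map `(u, v, w) ↦ (uw, vw, w)`. -/
theorem hasFDerivAt_blowDown (p : Fin 3 → ℝ) :
    HasFDerivAt (fun q : Fin 3 → ℝ => ![q 0 * q 2, q 1 * q 2, q 2])
      (ContinuousLinearMap.pi
        ![p 0 • ContinuousLinearMap.proj (R := ℝ) (φ := fun _ : Fin 3 => ℝ) 2 +
            p 2 • ContinuousLinearMap.proj (R := ℝ) (φ := fun _ : Fin 3 => ℝ) 0,
          p 1 • ContinuousLinearMap.proj (R := ℝ) (φ := fun _ : Fin 3 => ℝ) 2 +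
            p 2 • ContinuousLinearMap.proj (R := ℝ) (φ := fun _ : Fin 3 => ℝ) 1,
          ContinuousLinearMap.proj (R := ℝ) (φ := fun _ : Fin 3 => ℝ) 2]) p := by
  refine hasFDerivAt_pi.2 fun i => ?_
  fin_cases i
  · exact (hasFDerivAt_apply 0 p).mul (hasFDerivAt_apply 2 p)
  · exact (hasFDerivAt_apply 1 p).mul (hasFDerivAt_apply 2 p)
  · exact hasFDerivAt_apply 2 p

/-- Partial derivatives of a function composed with the blow-down map. -/
theorem fderiv_comp_blowDown {F : (Fin 3 → ℝ) → ℝ} {σ : (Fin 3 → ℝ) → (Fin 3 → ℝ)}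
    (hσ : ∀ p : Fin 3 → ℝ, σ p = ![p 0 * p 2, p 1 * p 2, p 2]) (p : Fin 3 → ℝ)
    (hF : DifferentiableAt ℝ F (σ p)) :
    DifferentiableAt ℝ (fun q => F (σ q)) p ∧
      fderiv ℝ (fun q => F (σ q)) p (Pi.single 0 1) =
        p 2 * fderiv ℝ F (σ p) (Pi.single 0 1) ∧
      fderiv ℝ (fun q => F (σ q)) p (Pi.single 1 1) =
        p 2 * fderiv ℝ F (σ p) (Pi.single 1 1) ∧
      fderiv ℝ (fun q => F (σ q)) p (Pi.single 2 1) =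
        p 0 * fderiv ℝ F (σ p) (Pi.single 0 1) + p 1 * fderiv ℝ F (σ p) (Pi.single 1 1) +
          fderiv ℝ F (σ p) (Pi.single 2 1) := by
  have hd := hasFDerivAt_blowDown p
  rw [← funext hσ] at hd
  have h : HasFDerivAt (fun q => F (σ q)) _ p := hF.hasFDerivAt.comp p hd
  refine ⟨h.differentiableAt, ?_, ?_, ?_⟩ <;>
    simp only [h.fderiv, ContinuousLinearMap.comp_apply, ← smul_eq_mul, ← map_smul, ← map_add] <;>
    congr 1 <;> ext i <;> fin_cases i <;> simp

/-- Partial derivatives of `(F - u G) / w` along a horizontal coordinate `u`. -/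
theorem fderiv_sub_mul_div_single {F G : (Fin 3 → ℝ) → ℝ} {p : Fin 3 → ℝ} {i : Fin 3}
    (hi : i ≠ 2) (hF : DifferentiableAt ℝ F p) (hG : DifferentiableAt ℝ G p) (hp : p 2 ≠ 0) :
    fderiv ℝ (fun q => (F q - q i * G q) / q 2) p (Pi.single i 1) =
      (fderiv ℝ F p (Pi.single i 1) - p i * fderiv ℝ G p (Pi.single i 1) - G p) / p 2 := by
  have h := (hF.hasFDerivAt.sub ((hasFDerivAt_apply i p).mul hG.hasFDerivAt)).mul
    ((hasDerivAt_inv hp).comp_hasFDerivAt p (hasFDerivAt_apply (𝕜 := ℝ) 2 p))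
  have h' : HasFDerivAt (fun q => (F q - q i * G q) / q 2) _ p := h
  rw [h'.fderiv]
  simp [Pi.single_eq_of_ne hi.symm]
  field_simp
  ring

/-- divergence transformation formula under the blow-down map
`σ(u,v,w) = (uw, vw, w)`: for `w ≠ 0`,
`div Z*(p) = (div Z)(σ(p)) − (2/w)·C(σ(p))` where `Z = (A, B, C)` and `Z* = dσ⁻¹(Z)`. -/
theorem stmt11 (A B C : (Fin 3 → ℝ) → ℝ)
    (hA : ContDiff ℝ 1 A) (hB : ContDiff ℝ 1 B) (hC : ContDiff ℝ 1 C)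
    (σ : (Fin 3 → ℝ) → (Fin 3 → ℝ))
    (hσ : ∀ p : Fin 3 → ℝ, σ p = ![p 0 * p 2, p 1 * p 2, p 2])
    (Zs : (Fin 3 → ℝ) → (Fin 3 → ℝ))
    (hZs : ∀ p : Fin 3 → ℝ, p 2 ≠ 0 →
      Zs p = ![(A (σ p) - p 0 * C (σ p)) / p 2,
               (B (σ p) - p 1 * C (σ p)) / p 2,
               C (σ p)])
    (p : Fin 3 → ℝ) (hp : p 2 ≠ 0) :
    (∑ i, fderiv ℝ (fun q => Zs q i) p (Pi.single i 1))
      = (fderiv ℝ A (σ p) (Pi.single 0 1) + fderiv ℝ B (σ p) (Pi.single 1 1)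
          + fderiv ℝ C (σ p) (Pi.single 2 1))
        - (2 / p 2) * C (σ p) := by
  have hnear : ∀ᶠ q : Fin 3 → ℝ in nhds p, q 2 ≠ 0 :=
    (continuous_apply 2).continuousAt.eventually_ne hp
  have e0 : (fun q => Zs q 0) =ᶠ[nhds p] fun q => (A (σ q) - q 0 * C (σ q)) / q 2 := by
    filter_upwards [hnear] with q hq
    simp [hZs q hq]
  have e1 : (fun q => Zs q 1) =ᶠ[nhds p] fun q => (B (σ q) - q 1 * C (σ q)) / q 2 := by
    filter_upwards [hnear] with q hq
    simp [hZs q hq]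
  have e2 : (fun q => Zs q 2) =ᶠ[nhds p] fun q => C (σ q) := by
    filter_upwards [hnear] with q hq
    simp [hZs q hq]
  obtain ⟨dA, hA0, -, -⟩ := fderiv_comp_blowDown hσ p (hA.differentiable one_ne_zero (σ p))
  obtain ⟨dB, -, hB1, -⟩ := fderiv_comp_blowDown hσ p (hB.differentiable one_ne_zero (σ p))
  obtain ⟨dC, hC0, hC1, hC2⟩ := fderiv_comp_blowDown hσ p (hC.differentiable one_ne_zero (σ p))
  rw [Fin.sum_univ_three, e0.fderiv_eq, e1.fderiv_eq, e2.fderiv_eq,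
    fderiv_sub_mul_div_single (by decide) dA dC hp,
    fderiv_sub_mul_div_single (by decide) dB dC hp, hA0, hB1, hC0, hC1, hC2]
  field_simp
  ring
end

section
/- Let X, Y : ℝ³ → ℝ³ be C² vector fields, let h(x₁, x₂, x₃) = x₃² − x₁² − x₂², and define the vector field Z = ⟨∇h, X⟩·Y − ⟨∇h, Y⟩·X on ℝ³. Let σ(u, v, w) = (uw, vw, w) and for w ≠ 0 let Z* be the pull-back of Z by σ, i.e. the unique vector field with Dσ(p)(Z*(p)) = Z(σ(p)). Then for every point p = (u, v, w) with u² + v² = 1 and w ≠ 0, setting N = (u, v, 0): div Z*(p) − ⟨DZ*(p)(N), N⟩ = (div Z)(σ(p)). In other words, on the cylinder Σ̃ = {u² + v² = 1} (away from {w = 0}) the divergence of Z* with respect to the metric induced by the Euclidean metric equals the pull-back of the Euclidean divergence of Z. -/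
open ContinuousLinearMap in
/-- The gradient of `x₃² − x₁² − x₂²`. -/
theorem hasFDerivAt_cone (x : Fin 3 → ℝ) :
    HasFDerivAt (fun q : Fin 3 → ℝ => (q 2) ^ 2 - (q 0) ^ 2 - (q 1) ^ 2)
      ((2 * x 2) • proj (R := ℝ) (φ := fun _ : Fin 3 => ℝ) 2
        - (2 * x 0) • proj (R := ℝ) (φ := fun _ : Fin 3 => ℝ) 0
        - (2 * x 1) • proj (R := ℝ) (φ := fun _ : Fin 3 => ℝ) 1) x := by
  have e (i : Fin 3) := (hasFDerivAt_apply (𝕜 := ℝ) (F' := fun _ : Fin 3 => ℝ) i x).pow 2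
  refine (((e 2).sub (e 0)).sub (e 1)).congr_fderiv ?_
  ext v
  simp

open ContinuousLinearMap in
/-- The derivative of the blow-up map `(u, v, w) ↦ (uw, vw, w)`. -/
theorem hasFDerivAt_blowup (p : Fin 3 → ℝ) :
    HasFDerivAt (fun q : Fin 3 → ℝ => (![q 0 * q 2, q 1 * q 2, q 2] : Fin 3 → ℝ))
      (ContinuousLinearMap.pi
        ![p 0 • proj (R := ℝ) (φ := fun _ : Fin 3 => ℝ) 2
            + p 2 • proj (R := ℝ) (φ := fun _ : Fin 3 => ℝ) 0,
          p 1 • proj (R := ℝ) (φ := fun _ : Fin 3 => ℝ) 2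
            + p 2 • proj (R := ℝ) (φ := fun _ : Fin 3 => ℝ) 1,
          proj (R := ℝ) (φ := fun _ : Fin 3 => ℝ) 2]) p := by
  have e (i : Fin 3) := hasFDerivAt_apply (𝕜 := ℝ) (F' := fun _ : Fin 3 => ℝ) i p
  rw [hasFDerivAt_pi']
  intro i
  fin_cases i
  · exact ((e 0).mul (e 2)).congr_fderiv (by ext v; simp)
  · exact ((e 1).mul (e 2)).congr_fderiv (by ext v; simp)
  · exact (e 2).congr_fderiv (by ext v; simp)

/-- Expansion of a linear map in the standard basis of `ℝ³`. -/
theorem clm_apply_fin_three (A : (Fin 3 → ℝ) →L[ℝ] (Fin 3 → ℝ)) (v : Fin 3 → ℝ) (i : Fin 3) :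
    A v i = v 0 * A (Pi.single 0 1) i + v 1 * A (Pi.single 1 1) i
      + v 2 * A (Pi.single 2 1) i := by
  conv_lhs => rw [pi_eq_sum_univ' v]
  have e (j : Fin 3) : (fun k : Fin 3 => if j = k then (1 : ℝ) else 0) = Pi.single j 1 := by
    ext k; simp [Pi.single_apply, eq_comm]
  simp [Fin.sum_univ_three, ← e]

/-- on the cylinder `{u² + v² = 1}` (away from `{w = 0}`), the divergence
of the pull-back `Z*` of `Z = (∇h·X)Y − (∇h·Y)X` (with `h = x₃² − x₁² − x₂²`) with
respect to the induced metric, i.e. `div Z* − ⟨DZ*(N), N⟩` with `N = (u, v, 0)`,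
equals the pull-back of the Euclidean divergence of `Z`. -/
theorem stmt12 (X Y : (Fin 3 → ℝ) → (Fin 3 → ℝ))
    (hX : ContDiff ℝ 2 X) (hY : ContDiff ℝ 2 Y)
    (h : (Fin 3 → ℝ) → ℝ)
    (hh : h = fun q => (q 2) ^ 2 - (q 0) ^ 2 - (q 1) ^ 2)
    (Z : (Fin 3 → ℝ) → (Fin 3 → ℝ))
    (hZ : ∀ x, Z x = (∑ i, fderiv ℝ h x (Pi.single i 1) * X x i) • Y x
                  - (∑ i, fderiv ℝ h x (Pi.single i 1) * Y x i) • X x)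
    (σ : (Fin 3 → ℝ) → (Fin 3 → ℝ))
    (hσ : ∀ p : Fin 3 → ℝ, σ p = ![p 0 * p 2, p 1 * p 2, p 2])
    (Zs : (Fin 3 → ℝ) → (Fin 3 → ℝ))
    (hZs : ∀ p : Fin 3 → ℝ, p 2 ≠ 0 → fderiv ℝ σ p (Zs p) = Z (σ p))
    (p : Fin 3 → ℝ) (hp1 : (p 0) ^ 2 + (p 1) ^ 2 = 1) (hp2 : p 2 ≠ 0) :
    (∑ i, fderiv ℝ (fun q => Zs q i) p (Pi.single i 1))
        - (∑ i, fderiv ℝ Zs p ![p 0, p 1, 0] i * (![p 0, p 1, 0] : Fin 3 → ℝ) i)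
      = ∑ i, fderiv ℝ (fun q => Z q i) (σ p) (Pi.single i 1) := by
  have fderiv_h (x v : Fin 3 → ℝ) :
      fderiv ℝ h x v = 2 * x 2 * v 2 - 2 * x 0 * v 0 - 2 * x 1 * v 1 := by
    rw [hh, (hasFDerivAt_cone x).fderiv]
    simp
  have Z_eq (x : Fin 3 → ℝ) :
      Z x = (2 * x 2 * X x 2 - 2 * x 0 * X x 0 - 2 * x 1 * X x 1) • Y x
        - (2 * x 2 * Y x 2 - 2 * x 0 * Y x 0 - 2 * x 1 * Y x 1) • X x := by
    rw [hZ]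
    simp only [fderiv_h, Fin.sum_univ_three]
    congr 2 <;> simp <;> ring
  have tangent (x : Fin 3 → ℝ) : x 2 * Z x 2 - x 0 * Z x 0 - x 1 * Z x 1 = 0 := by
    rw [Z_eq]
    simp only [Pi.sub_apply, Pi.smul_apply, smul_eq_mul]
    ring
  have hXd : Differentiable ℝ X := hX.differentiable (by norm_num)
  have hYd : Differentiable ℝ Y := hY.differentiable (by norm_num)
  have hZd : Differentiable ℝ Z := by
    rw [funext Z_eq]
    fun_prop
  obtain rfl : σ = fun q => ![q 0 * q 2, q 1 * q 2, q 2] := funext hσ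
  set s : Fin 3 → ℝ := ![p 0 * p 2, p 1 * p 2, p 2] with hs
  set A := fderiv ℝ Z s
  have hZA : HasFDerivAt Z A s := (hZd s).hasFDerivAt
  have hZi (i : Fin 3) := hasFDerivAt_pi'.1 hZA i
  have hZσ := hZA.comp p (hasFDerivAt_blowup p)
  have hZσi (i : Fin 3) := hasFDerivAt_pi'.1 hZσ i
  have e (x : Fin 3 → ℝ) (i : Fin 3) :=
    hasFDerivAt_apply (𝕜 := ℝ) (F' := fun _ : Fin 3 => ℝ) i x
  have hinv := (hasDerivAt_inv hp2).comp_hasFDerivAt p (e p 2)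
  have Zs_eq : Zs =ᶠ[nhds p] fun q =>
      ![(Z ![q 0 * q 2, q 1 * q 2, q 2] 0 - q 0 * Z ![q 0 * q 2, q 1 * q 2, q 2] 2) * (q 2)⁻¹,
        (Z ![q 0 * q 2, q 1 * q 2, q 2] 1 - q 1 * Z ![q 0 * q 2, q 1 * q 2, q 2] 2) * (q 2)⁻¹,
        Z ![q 0 * q 2, q 1 * q 2, q 2] 2] := by
    filter_upwards [(continuous_apply 2).continuousAt.eventually_ne hp2] with q hq
    have key := hZs q hq
    rw [(hasFDerivAt_blowup q).fderiv] at key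
    have k0 := congrFun key 0
    have k1 := congrFun key 1
    have k2 := congrFun key 2
    simp at k0 k1 k2
    ext i
    fin_cases i
    · simp [← k0, ← k2]
      field_simp
    · simp [← k1, ← k2]
      field_simp
    · simp [← k2]
  have D0 := ((hZσi 0).sub ((e p 0).mul (hZσi 2))).mul hinv
  have D1 := ((hZσi 1).sub ((e p 1).mul (hZσi 2))).mul hinv
  have Zs_eq_apply (i : Fin 3) := Zs_eq.fun_comp fun v => v i
  have E0 := D0.congr_of_eventuallyEq (Zs_eq_apply 0)
  have E1 := D1.congr_of_eventuallyEq (Zs_eq_apply 1)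
  have E2 := (hZσi 2).congr_of_eventuallyEq (Zs_eq_apply 2)
  have hD : DifferentiableAt ℝ Zs p := by
    refine differentiableAt_pi.2 fun i => ?_
    fin_cases i
    exacts [E0.differentiableAt, E1.differentiableAt, E2.differentiableAt]
  have hDi (v : Fin 3 → ℝ) (i : Fin 3) :
      fderiv ℝ Zs p v i = fderiv ℝ (fun q => Zs q i) p v := by
    rw [fderiv_pi (differentiableAt_pi.1 hD)]
    rfl
  have hT : HasFDerivAt (fun x => x 2 * Z x 2 - x 0 * Z x 0 - x 1 * Z x 1) _ s :=
    (((e s 2).mul (hZi 2)).sub ((e s 0).mul (hZi 0))).sub ((e s 1).mul (hZi 1))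
  have T := congrArg (fun L => L ![p 0, p 1, 0])
    (hT.unique ((hasFDerivAt_const (0 : ℝ) s).congr_of_eventuallyEq (.of_forall tangent)))
  have T0 := tangent s
  simp only [hDi, Fin.sum_univ_three]
  erw [E0.fderiv, E1.fderiv, E2.fderiv]
  simp [hs] at T T0 ⊢
  have hL (v : Fin 3 → ℝ) :
      (fun i => (![p 0 • ContinuousLinearMap.proj (R := ℝ) (φ := fun _ : Fin 3 => ℝ) 2
            + p 2 • ContinuousLinearMap.proj (R := ℝ) (φ := fun _ : Fin 3 => ℝ) 0,
          p 1 • ContinuousLinearMap.proj (R := ℝ) (φ := fun _ : Fin 3 => ℝ) 2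
            + p 2 • ContinuousLinearMap.proj (R := ℝ) (φ := fun _ : Fin 3 => ℝ) 1,
          ContinuousLinearMap.proj (R := ℝ) (φ := fun _ : Fin 3 => ℝ) 2] i) v)
        = ![p 0 * v 2 + p 2 * v 0, p 1 * v 2 + p 2 * v 1, v 2] := by
    ext i
    fin_cases i <;> simp
  simp only [hL]
  simp [clm_apply_fin_three A ![_, _, _]] at T ⊢
  simp only [← hs] at T T0 ⊢
  simp only [fun i => (hZi i).fderiv]
  simp
  have hZ2 : Z s 2 = p 0 * Z s 0 + p 1 * Z s 1 :=
    mul_left_cancel₀ hp2 (by linear_combination T0)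
  field_simp
  linear_combination T - hZ2 +
    (p 2 * (p 0 * A (Pi.single 0 1) 2 + p 1 * A (Pi.single 1 1) 2) + Z s 2) * hp1
end

section
/- Let X¹, X² : ℝ³ → ℝ³ be C¹ vector fields, u₁, u₂ ∈ L¹([0,1], ℝ), and let γ : [0,1] → ℝ³ be absolutely continuous with γ̇(t) = u₁(t)X¹(γ(t)) + u₂(t)X²(γ(t)) for almost every t. Suppose there are continuous functions λ₁, λ₂ : [0,1] → ℝ such that [X¹, X²](γ(t)) = λ₁(t)·X¹(γ(t)) + λ₂(t)·X²(γ(t)) for every t ∈ [0,1]. Let p : [0,1] → ℝ³ be absolutely continuous with ṗ(t) = −(u₁(t)(DX¹(γ(t)))ᵀ + u₂(t)(DX²(γ(t)))ᵀ) p(t) for almost every t, and suppose ⟨p(0), X¹(γ(0))⟩ = ⟨p(0), X²(γ(0))⟩ = 0. Then ⟨p(t), X¹(γ(t))⟩ = ⟨p(t), X²(γ(t))⟩ = 0 for every t ∈ [0,1]. -/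
open MeasureTheory

section AbsolutelyContinuous

open Set Filter

variable {X Y : Type*} [PseudoMetricSpace X] [PseudoMetricSpace Y] {a b : ℝ}

theorem AbsolutelyContinuousOnInterval.of_dist_le_mul {f : ℝ → X} {g : ℝ → Y}
    (hf : AbsolutelyContinuousOnInterval f a b) (K : ℝ)
    (hfg : ∀ x ∈ uIcc a b, ∀ y ∈ uIcc a b, dist (g x) (g y) ≤ K * dist (f x) (f y)) :
    AbsolutelyContinuousOnInterval g a b := by
  have hK := Tendsto.const_mul K hf
  rw [mul_zero] at hK
  refine squeeze_zero' (Eventually.of_forall fun E ↦ Finset.sum_nonneg fun _ _ ↦ dist_nonneg)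
    ?_ hK
  filter_upwards [mem_inf_of_right (mem_principal_self _)] with E hE
  rw [Finset.mul_sum]
  exact Finset.sum_le_sum fun i hi ↦ hfg _ (hE.1 i hi).1 _ (hE.1 i hi).2

/-- An antiderivative of an integrable vector-valued function is absolutely continuous. -/
theorem AbsolutelyContinuousOnInterval.of_eq_add_integral {E : Type*} [NormedAddCommGroup E]
    [NormedSpace ℝ E] {f f' : ℝ → E} (hf' : IntervalIntegrable f' volume a b)
    (hf : ∀ t ∈ uIcc a b, f t = f a + ∫ s in a..t, f' s) :
    AbsolutelyContinuousOnInterval f a b := by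
  refine (hf'.norm.absolutelyContinuousOnInterval_intervalIntegral
    (left_mem_uIcc (a := a) (b := b))).of_dist_le_mul 1 fun x hx y hy ↦ ?_
  have hax := hf'.mono_set (uIcc_subset_uIcc left_mem_uIcc hx)
  have hay := hf'.mono_set (uIcc_subset_uIcc left_mem_uIcc hy)
  rw [hf x hx, hf y hy, one_mul, dist_add_left, dist_comm, dist_eq_norm,
    intervalIntegral.integral_interval_sub_left hay hax, dist_comm, dist_eq_norm,
    intervalIntegral.integral_interval_sub_left hay.norm hax.norm, Real.norm_eq_abs]
  exact intervalIntegral.norm_integral_le_abs_integral_norm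

theorem ae_hasDerivAt_of_eq_add_integral {E : Type*} [NormedAddCommGroup E]
    [NormedSpace ℝ E] [CompleteSpace E] {f f' : ℝ → E} (hf' : IntervalIntegrable f' volume a b)
    (hf : ∀ t ∈ uIcc a b, f t = f a + ∫ s in a..t, f' s) :
    ∀ᵐ t, t ∈ uIcc a b → HasDerivAt f (f' t) t := by
  filter_upwards [hf'.ae_hasDerivAt_integral, Measure.ae_ne volume (min a b),
    Measure.ae_ne volume (max a b)] with t ht hmin hmax htab
  refine ((ht htab a left_mem_uIcc).const_add (f a)).congr_of_eventuallyEq ?_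
  filter_upwards [Icc_mem_nhds (lt_of_le_of_ne htab.1 hmin.symm) (lt_of_le_of_ne htab.2 hmax)]
    with s hs using hf s hs

theorem ContDiff.comp_absolutelyContinuousOnInterval {E F : Type*} [NormedAddCommGroup E]
    [NormedSpace ℝ E] [ProperSpace E] [NormedAddCommGroup F] [NormedSpace ℝ F]
    {g : E → F} {f : ℝ → E} (hg : ContDiff ℝ 1 g) (hf : AbsolutelyContinuousOnInterval f a b) :
    AbsolutelyContinuousOnInterval (fun t ↦ g (f t)) a b := by
  obtain ⟨R, hR⟩ := hf.exists_bound
  obtain ⟨K, hK⟩ := (hg.contDiffOn (s := Metric.closedBall 0 R)).exists_lipschitzOnWith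
    one_ne_zero (convex_closedBall 0 R) (isCompact_closedBall 0 R)
  refine hf.of_dist_le_mul K fun x hx y hy ↦ hK.dist_le_mul _ ?_ _ ?_
  · simpa using hR x hx
  · simpa using hR y hy

/-- Grönwall's inequality with zero initial value and an integrable rate. -/
theorem AbsolutelyContinuousOnInterval.nonpos_of_ae_deriv_le_mul {w k : ℝ → ℝ} (hab : a ≤ b)
    (hw : AbsolutelyContinuousOnInterval w a b) (hk : IntervalIntegrable k volume a b)
    (hwk : ∀ᵐ t, t ∈ uIcc a b → deriv w t ≤ k t * w t) (hwa : w a = 0) :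
    ∀ t ∈ uIcc a b, w t ≤ 0 := by
  intro t ht
  let I : ℝ → ℝ := fun t ↦ ∫ s in a..t, k s
  let v : ℝ → ℝ := fun t ↦ w t * Real.exp (-I t)
  have hI : AbsolutelyContinuousOnInterval I a b :=
    hk.absolutelyContinuousOnInterval_intervalIntegral left_mem_uIcc
  have hv : AbsolutelyContinuousOnInterval v a b :=
    hw.fun_mul (Real.contDiff_exp.comp_absolutelyContinuousOnInterval hI.neg)
  have hv' : ∀ᵐ t, t ∈ uIcc a b → deriv v t ≤ 0 := by
    filter_upwards [hw.ae_differentiableAt, hk.ae_hasDerivAt_integral, hwk] with s hws hIs hs hsab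
    have hd := (hws hsab).hasDerivAt.mul (hIs hsab a left_mem_uIcc).neg.exp
    have hvs : deriv v s = (deriv w s - k s * w s) * Real.exp (-I s) :=
      hd.deriv.trans (by simp only [I, Pi.neg_apply]; ring)
    rw [hvs]
    exact mul_nonpos_of_nonpos_of_nonneg (sub_nonpos.2 (hs hsab)) (Real.exp_pos _).le
  have hsub := uIcc_subset_uIcc left_mem_uIcc ht
  have hat : a ≤ t := by rw [uIcc_of_le hab] at ht; exact ht.1
  have hint := (hv.mono hsub).integral_deriv_eq_sub
  have hle : ∫ s in a..t, deriv v s ≤ 0 := by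
    rw [intervalIntegral.integral_of_le hat]
    refine integral_nonpos_of_ae ((ae_restrict_iff' measurableSet_Ioc).2 ?_)
    filter_upwards [hv'] with s hs hst
    exact hs (hsub (by rw [uIcc_of_le hat]; exact Ioc_subset_Icc_self hst))
  have hva : v a = 0 := by simp [v, hwa]
  rw [hint, hva, sub_zero] at hle
  exact nonpos_of_mul_nonpos_left hle (Real.exp_pos _)

end AbsolutelyContinuous

section Pairing

variable {ι : Type*} [Fintype ι] {Y : (ι → ℝ) → ι → ℝ}

theorem HasDerivAt.dotProduct_comp {γ p : ℝ → ι → ℝ} {γ' p' : ι → ℝ} {t : ℝ}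
    (hY : DifferentiableAt ℝ Y (γ t)) (hγ : HasDerivAt γ γ' t) (hp : HasDerivAt p p' t) :
    HasDerivAt (fun s ↦ ∑ m, p s m * Y (γ s) m)
      (∑ m, p' m * Y (γ t) m + ∑ m, p t m * fderiv ℝ Y (γ t) γ' m) t := by
  rw [← Finset.sum_add_distrib]
  exact HasDerivAt.fun_sum fun m _ ↦ (hasDerivAt_pi.1 hp m).fun_mul
    (hasDerivAt_pi.1 (hY.hasFDerivAt.comp_hasDerivAt t hγ) m)

/-- The product of the transpose of the derivative matrix of `Y` at `x` with `q`. -/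
noncomputable def transposeFDeriv [DecidableEq ι] (Y : (ι → ℝ) → ι → ℝ) (x q : ι → ℝ) : ι → ℝ :=
  fun i ↦ ∑ m, q m * fderiv ℝ (fun y ↦ Y y m) x (Pi.single i 1)

theorem sum_transposeFDeriv_mul [DecidableEq ι] {x : ι → ℝ} (hY : DifferentiableAt ℝ Y x)
    (q v : ι → ℝ) :
    ∑ i, transposeFDeriv Y x q i * v i = ∑ m, q m * fderiv ℝ Y x v m := by
  simp only [transposeFDeriv, Finset.sum_mul]
  rw [Finset.sum_comm]
  refine Finset.sum_congr rfl fun m _ ↦ ?_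
  have hm : fderiv ℝ Y x v m = fderiv ℝ (fun y ↦ Y y m) x v := by
    rw [fderiv_pi (differentiableAt_pi.1 hY)]; rfl
  rw [hm]
  conv_rhs => rw [pi_eq_sum_univ' v, map_sum, Finset.mul_sum]
  refine Finset.sum_congr rfl fun i _ ↦ ?_
  rw [map_smul, smul_eq_mul]
  ring

theorem ContinuousOn.transposeFDeriv [DecidableEq ι] (hY : ContDiff ℝ 1 Y) {γ p : ℝ → ι → ℝ}
    {s : Set ℝ} (hγ : ContinuousOn γ s) (hp : ContinuousOn p s) :
    ContinuousOn (fun t ↦ transposeFDeriv Y (γ t) (p t)) s := by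
  refine continuousOn_pi.2 fun i ↦ continuousOn_finsetSum _ fun m _ ↦ ?_
  exact (continuousOn_pi.1 hp m).mul
    ((((contDiff_pi.1 hY m).continuous_fderiv one_ne_zero).comp_continuousOn hγ).clm_apply
      continuousOn_const)

theorem AbsolutelyContinuousOnInterval.sum_mul_comp {γ p : ℝ → ι → ℝ} {a b : ℝ}
    (hp : AbsolutelyContinuousOnInterval p a b) (hγ : AbsolutelyContinuousOnInterval γ a b)
    (hY : ContDiff ℝ 1 Y) :
    AbsolutelyContinuousOnInterval (fun t ↦ ∑ m, p t m * Y (γ t) m) a b := by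
  have hpm (m : ι) : AbsolutelyContinuousOnInterval (fun t ↦ p t m) a b :=
    ContDiff.comp_absolutelyContinuousOnInterval (g := fun v : ι → ℝ ↦ v m)
      (contDiff_apply ℝ ℝ m) hp
  have hYm (m : ι) : AbsolutelyContinuousOnInterval (fun t ↦ Y (γ t) m) a b :=
    ContDiff.comp_absolutelyContinuousOnInterval (g := fun x ↦ Y x m) (contDiff_pi.1 hY m) hγ
  have hsum := Finset.sum_induction (s := Finset.univ) (fun m t ↦ p t m * Y (γ t) m)
    (AbsolutelyContinuousOnInterval · a b) (fun _ _ ↦ AbsolutelyContinuousOnInterval.add)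
    (LipschitzWith.const (0 : ℝ)).lipschitzOnWith.absolutelyContinuousOnInterval
    (fun m _ ↦ (hpm m).fun_mul (hYm m))
  exact (funext fun t ↦ Finset.sum_apply t _ _ :
    (∑ m, fun t ↦ p t m * Y (γ t) m) = fun t ↦ ∑ m, p t m * Y (γ t) m) ▸ hsum

end Pairing

/-- if `γ` is a horizontal path along which `[X¹, X²](γ(t))` lies in the
span of `X¹(γ(t))`, `X²(γ(t))`, and `p` solves the adjoint equation with
`⟨p(0), X¹(γ(0))⟩ = ⟨p(0), X²(γ(0))⟩ = 0`, then `⟨p(t), Xⁱ(γ(t))⟩ = 0` for all `t`. -/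
theorem stmt14 (X1 X2 : (Fin 3 → ℝ) → (Fin 3 → ℝ))
    (hX1 : ContDiff ℝ 1 X1) (hX2 : ContDiff ℝ 1 X2)
    (u1 u2 : ℝ → ℝ)
    (hu1 : IntegrableOn u1 (Set.Icc (0:ℝ) 1)) (hu2 : IntegrableOn u2 (Set.Icc (0:ℝ) 1))
    (γ p : ℝ → (Fin 3 → ℝ))
    (hγc : ContinuousOn γ (Set.Icc (0:ℝ) 1)) (hpc : ContinuousOn p (Set.Icc (0:ℝ) 1))
    (hγ : ∀ t ∈ Set.Icc (0:ℝ) 1,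
      γ t = γ 0 + ∫ s in (0:ℝ)..t, (u1 s • X1 (γ s) + u2 s • X2 (γ s)))
    (lam1 lam2 : ℝ → ℝ)
    (hlam1 : ContinuousOn lam1 (Set.Icc (0:ℝ) 1))
    (hlam2 : ContinuousOn lam2 (Set.Icc (0:ℝ) 1))
    (hbracket : ∀ t ∈ Set.Icc (0:ℝ) 1,
      fderiv ℝ X2 (γ t) (X1 (γ t)) - fderiv ℝ X1 (γ t) (X2 (γ t))
        = lam1 t • X1 (γ t) + lam2 t • X2 (γ t))
    (hp : ∀ t ∈ Set.Icc (0:ℝ) 1,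
      p t = p 0 + ∫ s in (0:ℝ)..t,
        -(u1 s • (fun i => ∑ m, p s m * fderiv ℝ (fun q => X1 q m) (γ s) (Pi.single i 1)
              : Fin 3 → ℝ)
          + u2 s • (fun i => ∑ m, p s m * fderiv ℝ (fun q => X2 q m) (γ s) (Pi.single i 1)
              : Fin 3 → ℝ)))
    (hp01 : ∑ m, p 0 m * X1 (γ 0) m = 0) (hp02 : ∑ m, p 0 m * X2 (γ 0) m = 0) :
    ∀ t ∈ Set.Icc (0:ℝ) 1,
      (∑ m, p t m * X1 (γ t) m) = 0 ∧ (∑ m, p t m * X2 (γ t) m) = 0 := by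
  rw [← Set.uIcc_of_le (zero_le_one' ℝ)] at *
  have hu1' : IntervalIntegrable u1 volume 0 1 := hu1.intervalIntegrable
  have hu2' : IntervalIntegrable u2 volume 0 1 := hu2.intervalIntegrable
  have hd1 := hX1.differentiable one_ne_zero
  have hd2 := hX2.differentiable one_ne_zero
  have hγ' := (hu1'.smul_continuousOn (hX1.continuous.comp_continuousOn hγc)).add
    (hu2'.smul_continuousOn (hX2.continuous.comp_continuousOn hγc))
  have hp' := ((hu1'.smul_continuousOn (hγc.transposeFDeriv hX1 hpc)).add
    (hu2'.smul_continuousOn (hγc.transposeFDeriv hX2 hpc))).neg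
  have hγac := AbsolutelyContinuousOnInterval.of_eq_add_integral hγ' hγ
  have hpac := AbsolutelyContinuousOnInterval.of_eq_add_integral hp' hp
  let h (Y : (Fin 3 → ℝ) → Fin 3 → ℝ) (t : ℝ) : ℝ := ∑ m, p t m * Y (γ t) m
  have hac {Y : (Fin 3 → ℝ) → Fin 3 → ℝ} (hY : ContDiff ℝ 1 Y) :
      AbsolutelyContinuousOnInterval (h Y) 0 1 :=
    hpac.sum_mul_comp hγac hY
  obtain ⟨L1, hL1⟩ := isCompact_uIcc.exists_bound_of_continuousOn hlam1
  obtain ⟨L2, hL2⟩ := isCompact_uIcc.exists_bound_of_continuousOn hlam2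
  have hw : AbsolutelyContinuousOnInterval (fun t ↦ h X1 t * h X1 t + h X2 t * h X2 t) 0 1 :=
    ((hac hX1).fun_mul (hac hX1)).fun_add ((hac hX2).fun_mul (hac hX2))
  have hk : IntervalIntegrable (fun t ↦ 2 * (L1 + L2) * (|u1 t| + |u2 t|)) volume 0 1 :=
    (hu1'.abs.add hu2'.abs).const_mul _
  have key := hw.nonpos_of_ae_deriv_le_mul zero_le_one hk ?_ (by simp [h, hp01, hp02])
  · intro t ht
    have := key t ht
    constructor
    · change h X1 t = 0
      nlinarith [mul_self_nonneg (h X1 t), mul_self_nonneg (h X2 t)]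
    · change h X2 t = 0
      nlinarith [mul_self_nonneg (h X1 t), mul_self_nonneg (h X2 t)]
  filter_upwards [ae_hasDerivAt_of_eq_add_integral hγ' hγ, ae_hasDerivAt_of_eq_add_integral hp' hp]
    with t hγt hpt ht
  have hβ : ∑ m, p t m * fderiv ℝ X2 (γ t) (X1 (γ t)) m
      - ∑ m, p t m * fderiv ℝ X1 (γ t) (X2 (γ t)) m = lam1 t * h X1 t + lam2 t * h X2 t := by
    have := congrArg (fun v ↦ ∑ m, p t m * v m) (hbracket t ht)
    simp only [h, Fin.sum_univ_three, Pi.sub_apply, Pi.add_apply, Pi.smul_apply, smul_eq_mul]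
      at this ⊢
    linarith
  have hder {Y : (Fin 3 → ℝ) → Fin 3 → ℝ} (hY : Differentiable ℝ Y) :
      HasDerivAt (h Y)
        (u1 t * (∑ m, p t m * fderiv ℝ Y (γ t) (X1 (γ t)) m
            - ∑ m, p t m * fderiv ℝ X1 (γ t) (Y (γ t)) m)
          + u2 t * (∑ m, p t m * fderiv ℝ Y (γ t) (X2 (γ t)) m
            - ∑ m, p t m * fderiv ℝ X2 (γ t) (Y (γ t)) m)) t := by
    refine (HasDerivAt.dotProduct_comp (hY _) (hγt ht) (hpt ht)).congr_deriv ?_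
    rw [← sum_transposeFDeriv_mul (hd1 (γ t)), ← sum_transposeFDeriv_mul (hd2 (γ t))]
    simp only [map_add, map_smul, Fin.sum_univ_three, Pi.neg_apply, Pi.add_apply, Pi.smul_apply,
      smul_eq_mul, Function.comp_apply]
    ring
  have h1 : HasDerivAt (h X1) (-u2 t * (lam1 t * h X1 t + lam2 t * h X2 t)) t :=
    (hder hd1).congr_deriv (by rw [← hβ]; ring)
  have h2 : HasDerivAt (h X2) (u1 t * (lam1 t * h X1 t + lam2 t * h X2 t)) t :=
    (hder hd2).congr_deriv (by rw [← hβ]; ring)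
  rw [((h1.fun_mul h1).fun_add (h2.fun_mul h2)).deriv]
  have hl1 : |lam1 t| ≤ L1 := hL1 t ht
  have hl2 : |lam2 t| ≤ L2 := hL2 t ht
  set x := h X1 t
  set y := h X2 t
  have hxM : |x| ≤ √(x * x + y * y) := Real.abs_le_sqrt (by nlinarith)
  have hyM : |y| ≤ √(x * x + y * y) := Real.abs_le_sqrt (by nlinarith)
  have hM : √(x * x + y * y) * √(x * x + y * y) = x * x + y * y :=
    Real.mul_self_sqrt (by nlinarith)
  set M := √(x * x + y * y)
  have hM0 : 0 ≤ M := Real.sqrt_nonneg _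
  have hL10 : 0 ≤ L1 := (abs_nonneg _).trans hl1
  have hA : |lam1 t * x + lam2 t * y| ≤ (L1 + L2) * M :=
    calc _ ≤ |lam1 t| * |x| + |lam2 t| * |y| := by
          simpa only [abs_mul] using abs_add_le (lam1 t * x) (lam2 t * y)
      _ ≤ L1 * M + L2 * M := by gcongr; exact (abs_nonneg _).trans hl2
      _ = _ := by ring
  have hB : |u1 t * y - u2 t * x| ≤ (|u1 t| + |u2 t|) * M :=
    calc _ ≤ |u1 t| * |y| + |u2 t| * |x| := by
          simpa only [abs_mul] using abs_sub (u1 t * y) (u2 t * x)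
      _ ≤ |u1 t| * M + |u2 t| * M := by gcongr
      _ = _ := by ring
  calc _ = 2 * ((lam1 t * x + lam2 t * y) * (u1 t * y - u2 t * x)) := by ring
    _ ≤ 2 * (|lam1 t * x + lam2 t * y| * |u1 t * y - u2 t * x|) := by
        rw [← abs_mul]; gcongr; exact le_abs_self _
    _ ≤ 2 * (((L1 + L2) * M) * ((|u1 t| + |u2 t|) * M)) := by
        gcongr; exact (abs_nonneg _).trans hA
    _ = 2 * (L1 + L2) * (|u1 t| + |u2 t|) * (M * M) := by ring
    _ = _ := by rw [hM]
end

section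
/- Let V ⊆ ℝ³ be open and let A¹, A² : V → ℝ be smooth; define X¹(x) = (1, 0, A¹(x)) and X²(x) = (0, 1, A²(x)). Assume the following Hörmander condition: for every y ∈ V there exist an integer r ≥ 2 and indices i₃, …, i_r ∈ {1, 2} such that, defining Z² = [X¹, X²] and Z^j = [Z^{j−1}, X^{i_j}] for 3 ≤ j ≤ r, the third component of Z^r is nonzero at y. Then the tangency set Σ_tan := {x ∈ V : x₃ = 0, A¹(x) = 0, A²(x) = 0} is contained in a countable union of one-dimensional smooth submanifolds of ℝ³; concretely, Σ_tan can be covered by countably many sets each of which is, after a permutation of the three coordinates, the graph {(t, g(t)) : t ∈ I} of a C^∞ map g : I → ℝ² on an open interval I ⊆ ℝ. -/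
/-- Lie bracket of two vector fields on `ℝ³`:
`[F, G](p) = DG(p)(F(p)) − DF(p)(G(p))`. -/
noncomputable def lie (F G : (Fin 3 → ℝ) → (Fin 3 → ℝ)) : (Fin 3 → ℝ) → (Fin 3 → ℝ) :=
  fun p => fderiv ℝ G p (F p) - fderiv ℝ F p (G p)

/-- Iterated brackets: `iterBr X1 X2 ι 0 = [X¹, X²]` and
`iterBr X1 X2 ι (m+1) = [iterBr X1 X2 ι m, X^{ι m}]`. -/
noncomputable def iterBr (X1 X2 : (Fin 3 → ℝ) → (Fin 3 → ℝ)) (ι : ℕ → Fin 2) :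
    ℕ → (Fin 3 → ℝ) → (Fin 3 → ℝ)
  | 0 => lie X1 X2
  | m + 1 => lie (iterBr X1 X2 ι m) (if ι m = 0 then X1 else X2)

open Filter Set
open scoped Topology ContDiff

theorem isInvertible_comp_inr_of_ne_zero {L : ℝ × ℝ →L[ℝ] ℝ} (h : L (0, 1) ≠ 0) :
    (L ∘L .inr ℝ ℝ ℝ).IsInvertible :=
  ⟨ContinuousLinearEquiv.unitsEquivAut ℝ (Units.mk0 _ h), by ext; simp⟩

/-- Near a regular zero, the zero set of a smooth function of two variables is contained in the
graph of a function which is smooth on an open interval. -/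
theorem exists_graph_of_fderiv_ne_zero {w : ℝ × ℝ → ℝ} {u : ℝ × ℝ}
    (hw : ∀ᶠ v in 𝓝 u, ContDiffAt ℝ ∞ w v) (hu : w u = 0) (hd : fderiv ℝ w u (0, 1) ≠ 0) :
    ∃ (I : Set ℝ) (g : ℝ → ℝ), IsOpen I ∧ I.OrdConnected ∧ ContDiffOn ℝ ∞ g I ∧
      ∀ᶠ v in 𝓝 u, w v = 0 → v.1 ∈ I ∧ v.2 = g v.1 := by
  have hn : (∞ : ℕ∞ω) ≠ 0 := by simp
  have hinv := isInvertible_comp_inr_of_ne_zero hd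
  set ψ := hw.self_of_nhds.implicitFunction hn hinv with hψ
  have hψu : ψ u.1 = u.2 := hw.self_of_nhds.implicitFunction_apply_self hn hinv
  have hψc : ∀ᶠ s in 𝓝 u.1, ContinuousAt ψ s :=
    (((hw.self_of_nhds.contDiffAt_implicitFunction hn hinv).of_le
      (m := 1) (by exact_mod_cast le_top)).eventually (by simp)).mono fun s hs => hs.continuousAt
  have hgraph : Tendsto (fun s => (s, ψ s)) (𝓝 u.1) (𝓝 u) := by
    have : ContinuousAt (fun s => (s, ψ s)) u.1 := continuousAt_id.prodMk hψc.self_of_nhds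
    simpa [ContinuousAt, hψu] using this
  have hzero := hw.self_of_nhds.eventually_apply_implicitFunction hn hinv
  have hiff := hw.self_of_nhds.eventually_apply_eq_iff_implicitFunction hn hinv
  rw [← hψ] at hzero hiff
  have hcont : ContinuousAt (fun v => fderiv ℝ w v (0, 1)) u :=
    ((hw.self_of_nhds.fderiv_right (m := 0) (by simp)).continuousAt).clm_apply continuousAt_const
  have hsmooth : ∀ᶠ s in 𝓝 u.1, ContDiffAt ℝ ∞ ψ s := by
    filter_upwards [hψc, hzero.eventually_nhds, hgraph.eventually hw,
      hgraph.eventually (hcont.eventually_ne hd)] with s hc hz hws hds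
    have hinv' := isInvertible_comp_inr_of_ne_zero hds
    have hiff' := hws.eventually_apply_eq_iff_implicitFunction hn hinv'
    have hlift : Tendsto (fun s' => (s', ψ s')) (𝓝 s) (𝓝 (s, ψ s)) :=
      continuousAt_id.prodMk hc
    refine (hws.contDiffAt_implicitFunction hn hinv').congr_of_eventuallyEq ?_
    filter_upwards [hlift.eventually hiff', hz] with s' h1 h2
    exact (h1.1 (h2.trans hz.self_of_nhds.symm)).symm
  obtain ⟨ε, hε, hball⟩ := Metric.eventually_nhds_iff_ball.1 hsmooth
  refine ⟨Metric.ball u.1 ε, ψ, Metric.isOpen_ball, (convex_ball _ _).ordConnected,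
    fun s hs => (hball s hs).contDiffWithinAt, ?_⟩
  filter_upwards [hiff, continuousAt_fst.eventually (Metric.ball_mem_nhds u.1 hε)] with v h1 h2 h3
  exact ⟨h2, (h1.1 (h3.trans hu.symm)).symm⟩

/-- The partial derivative of `φ` in the `i`-th coordinate direction. -/
noncomputable def partialDeriv (i : Fin 3) (φ : (Fin 3 → ℝ) → ℝ) : (Fin 3 → ℝ) → ℝ :=
  fun x => fderiv ℝ φ x (Pi.single i 1)

/-- Iterated partial derivatives in the first two coordinates; the head of the list acts first. -/
noncomputable def iterPartialDeriv : List (Fin 2) → ((Fin 3 → ℝ) → ℝ) → (Fin 3 → ℝ) → ℝ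
  | [], φ => φ
  | i :: l, φ => iterPartialDeriv l (partialDeriv i.castSucc φ)

section PartialDeriv

variable {V : Set (Fin 3 → ℝ)} {p : Fin 3 → ℝ} {φ ψ : (Fin 3 → ℝ) → ℝ}

theorem differentiableAt_of_contDiffOn (hV : IsOpen V) (hφ : ContDiffOn ℝ ∞ φ V) (hp : p ∈ V) :
    DifferentiableAt ℝ φ p :=
  (hφ.contDiffAt (hV.mem_nhds hp)).differentiableAt (by simp)

theorem contDiffOn_partialDeriv (hV : IsOpen V) (hφ : ContDiffOn ℝ ∞ φ V) (i : Fin 3) :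
    ContDiffOn ℝ ∞ (partialDeriv i φ) V :=
  (hφ.fderiv_of_isOpen hV (by simp)).clm_apply contDiffOn_const

theorem contDiffOn_iterPartialDeriv (hV : IsOpen V) (l : List (Fin 2))
    (hφ : ContDiffOn ℝ ∞ φ V) : ContDiffOn ℝ ∞ (iterPartialDeriv l φ) V := by
  induction l generalizing φ with
  | nil => exact hφ
  | cons i l ih => exact ih (contDiffOn_partialDeriv hV hφ _)

theorem iterPartialDeriv_congr (hV : IsOpen V) (l : List (Fin 2)) (h : EqOn φ ψ V) :
    EqOn (iterPartialDeriv l φ) (iterPartialDeriv l ψ) V := by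
  induction l generalizing φ ψ with
  | nil => exact h
  | cons i l ih =>
    refine ih fun x hx => ?_
    rw [partialDeriv, partialDeriv, (h.eventuallyEq_of_mem (hV.mem_nhds hx)).fderiv_eq]

theorem iterPartialDeriv_add (hV : IsOpen V) (l : List (Fin 2))
    (hφ : ContDiffOn ℝ ∞ φ V) (hψ : ContDiffOn ℝ ∞ ψ V) :
    EqOn (iterPartialDeriv l (φ + ψ)) (iterPartialDeriv l φ + iterPartialDeriv l ψ) V := by
  induction l generalizing φ ψ with
  | nil => exact eqOn_refl _ _
  | cons i l ih =>
    refine EqOn.trans (iterPartialDeriv_congr hV l fun x hx => ?_)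
      (ih (contDiffOn_partialDeriv hV hφ i.castSucc) (contDiffOn_partialDeriv hV hψ i.castSucc))
    simp [partialDeriv, fderiv_add (differentiableAt_of_contDiffOn hV hφ hx)
      (differentiableAt_of_contDiffOn hV hψ hx)]

/-- `φ` is smooth on `V` and all its iterated partial derivatives in the first two coordinates
vanish at `p`. -/
structure IsFlatAt (V : Set (Fin 3 → ℝ)) (p : Fin 3 → ℝ) (φ : (Fin 3 → ℝ) → ℝ) : Prop where
  contDiffOn : ContDiffOn ℝ ∞ φ V
  iterPartialDeriv_eq_zero : ∀ l, iterPartialDeriv l φ p = 0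

namespace IsFlatAt

theorem partialDeriv (hV : IsOpen V) (hφ : IsFlatAt V p φ) (i : Fin 2) :
    IsFlatAt V p (partialDeriv i.castSucc φ) :=
  ⟨contDiffOn_partialDeriv hV hφ.1 _, fun l => hφ.2 (i :: l)⟩

theorem add (hV : IsOpen V) (hp : p ∈ V) (hφ : IsFlatAt V p φ) (hψ : IsFlatAt V p ψ) :
    IsFlatAt V p (φ + ψ) :=
  ⟨hφ.1.add hψ.1, fun l => by
    simp [iterPartialDeriv_add hV l hφ.1 hψ.1 hp, hφ.2 l, hψ.2 l]⟩

theorem mul_right (hV : IsOpen V) (hp : p ∈ V) (hφ : IsFlatAt V p φ)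
    (hψ : ContDiffOn ℝ ∞ ψ V) : IsFlatAt V p (φ * ψ) := by
  refine ⟨hφ.1.mul hψ, fun l => ?_⟩
  induction l generalizing φ ψ with
  | nil =>
    have : φ p = 0 := hφ.2 []
    simp [iterPartialDeriv, this]
  | cons i l ih =>
    have hdφ := contDiffOn_partialDeriv hV hφ.1 i.castSucc
    have hdψ := contDiffOn_partialDeriv hV hψ i.castSucc
    have key : EqOn (_root_.partialDeriv i.castSucc (φ * ψ))
        (φ * _root_.partialDeriv i.castSucc ψ + _root_.partialDeriv i.castSucc φ * ψ) V := by
      intro x hx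
      simp [_root_.partialDeriv, fderiv_mul (differentiableAt_of_contDiffOn hV hφ.1 hx)
        (differentiableAt_of_contDiffOn hV hψ hx), mul_comm]
    have hadd := iterPartialDeriv_add hV l (φ := φ * _root_.partialDeriv i.castSucc ψ)
      (ψ := _root_.partialDeriv i.castSucc φ * ψ) (hφ.1.mul hdψ) (hdφ.mul hψ) hp
    rw [iterPartialDeriv, iterPartialDeriv_congr hV l key hp, hadd, Pi.add_apply, ih hφ hdψ,
      ih (hφ.partialDeriv hV i) hψ, add_zero]

theorem neg (hV : IsOpen V) (hp : p ∈ V) (hφ : IsFlatAt V p φ) : IsFlatAt V p (-φ) := by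
  have h : -φ = φ * fun _ => -1 := by
    ext
    simp
  exact h ▸ hφ.mul_right hV hp contDiffOn_const

theorem sub (hV : IsOpen V) (hp : p ∈ V) (hφ : IsFlatAt V p φ) (hψ : IsFlatAt V p ψ) :
    IsFlatAt V p (φ - ψ) :=
  sub_eq_add_neg φ ψ ▸ hφ.add hV hp (hψ.neg hV hp)

end IsFlatAt

theorem exists_iterPartialDeriv_eq_zero_and_ne_zero (l : List (Fin 2)) (h0 : φ p = 0)
    (hl : iterPartialDeriv l φ p ≠ 0) :
    ∃ (l' : List (Fin 2)) (i : Fin 2), iterPartialDeriv l' φ p = 0 ∧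
      partialDeriv i.castSucc (iterPartialDeriv l' φ) p ≠ 0 := by
  induction l generalizing φ with
  | nil => exact absurd h0 hl
  | cons i l ih =>
    by_cases h : partialDeriv i.castSucc φ p = 0
    · obtain ⟨l', j, h1, h2⟩ := ih h hl
      exact ⟨i :: l', j, h1, h2⟩
    · exact ⟨[], i, h0, h⟩

theorem fderiv_vec (a b : ℝ) (hφ : DifferentiableAt ℝ φ p) (v : Fin 3 → ℝ) :
    fderiv ℝ (fun y => ![a, b, φ y]) p v = ![0, 0, fderiv ℝ φ p v] := by
  have h : ∀ k : Fin 3, DifferentiableAt ℝ (fun y => (![a, b, φ y] : Fin 3 → ℝ) k) p := by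
    intro k
    fin_cases k
    · exact differentiableAt_const a
    · exact differentiableAt_const b
    · exact hφ
  rw [fderiv_pi h]
  ext k
  fin_cases k <;> simp

theorem fderiv_apply_vec (a b c : ℝ) :
    fderiv ℝ φ p ![a, b, c] =
      a * partialDeriv 0 φ p + b * partialDeriv 1 φ p + c * partialDeriv 2 φ p := by
  have : (![a, b, c] : Fin 3 → ℝ) =
      a • Pi.single 0 1 + b • Pi.single 1 1 + c • Pi.single 2 1 := by
    ext k
    fin_cases k <;> simp
  simp [this, partialDeriv]

/-- The bracket of a vertical field with a field of the normal form. -/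
theorem lie_vertical {Z X : (Fin 3 → ℝ) → (Fin 3 → ℝ)} {a b : ℝ} (hV : IsOpen V)
    (hφ : ContDiffOn ℝ ∞ φ V) (hψ : ContDiffOn ℝ ∞ ψ V)
    (hZ : EqOn Z (fun y => ![0, 0, φ y]) V) (hX : X = fun y => ![a, b, ψ y]) :
    EqOn (lie Z X) (fun y => ![0, 0, (φ * partialDeriv 2 ψ -
      ((partialDeriv 0 φ * fun _ => a) + (partialDeriv 1 φ * fun _ => b) +
        ψ * partialDeriv 2 φ) : (Fin 3 → ℝ) → ℝ) y]) V := by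
  intro y hy
  rw [lie, (hZ.eventuallyEq_of_mem (hV.mem_nhds hy)).fderiv_eq, hX,
    fderiv_vec _ _ (differentiableAt_of_contDiffOn hV hψ hy),
    fderiv_vec _ _ (differentiableAt_of_contDiffOn hV hφ hy), hZ hy,
    fderiv_apply_vec, fderiv_apply_vec]
  ext k
  fin_cases k <;> simp [mul_comm]

end PartialDeriv

/-- If the coefficients of a distribution in normal form are flat at `p` in the horizontal
directions, then so are all iterated brackets. -/
theorem exists_isFlatAt_iterBr {V : Set (Fin 3 → ℝ)} {p : Fin 3 → ℝ} (hV : IsOpen V) (hp : p ∈ V)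
    {A1 A2 : (Fin 3 → ℝ) → ℝ} {X1 X2 : (Fin 3 → ℝ) → (Fin 3 → ℝ)}
    (hX1 : X1 = fun y => ![1, 0, A1 y]) (hX2 : X2 = fun y => ![0, 1, A2 y])
    (hA1 : IsFlatAt V p A1) (hA2 : IsFlatAt V p A2) (ι : ℕ → Fin 2) (m : ℕ) :
    ∃ z, IsFlatAt V p z ∧ EqOn (iterBr X1 X2 ι m) (fun y => ![0, 0, z y]) V := by
  induction m with
  | zero =>
    refine ⟨(partialDeriv 0 A2 + A1 * partialDeriv 2 A2) -
      (partialDeriv 1 A1 + A2 * partialDeriv 2 A1), ?_, fun y hy => ?_⟩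
    · exact ((hA2.partialDeriv hV 0).add hV hp
        (hA1.mul_right hV hp (contDiffOn_partialDeriv hV hA2.1 2))).sub hV hp
        ((hA1.partialDeriv hV 1).add hV hp
        (hA2.mul_right hV hp (contDiffOn_partialDeriv hV hA1.1 2)))
    · rw [iterBr, lie, hX1, hX2, fderiv_vec _ _ (differentiableAt_of_contDiffOn hV hA1.1 hy),
        fderiv_vec _ _ (differentiableAt_of_contDiffOn hV hA2.1 hy),
        fderiv_apply_vec, fderiv_apply_vec]
      ext k
      fin_cases k <;> simp
  | succ m ih =>
    obtain ⟨z, hz, hZ⟩ := ih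
    have key : ∀ (X : (Fin 3 → ℝ) → (Fin 3 → ℝ)) (A : (Fin 3 → ℝ) → ℝ) (a b : ℝ),
        X = (fun y => ![a, b, A y]) → IsFlatAt V p A →
        ∃ z', IsFlatAt V p z' ∧ EqOn (lie (iterBr X1 X2 ι m) X) (fun y => ![0, 0, z' y]) V := by
      intro X A a b hX hA
      refine ⟨_, ?_, lie_vertical hV hz.1 hA.1 hZ hX⟩
      exact (hz.mul_right hV hp (contDiffOn_partialDeriv hV hA.1 2)).sub hV hp
        ((((hz.partialDeriv hV 0).mul_right hV hp contDiffOn_const).add hV hp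
          ((hz.partialDeriv hV 1).mul_right hV hp contDiffOn_const)).add hV hp
          (hA.mul_right hV hp (contDiffOn_partialDeriv hV hz.1 2)))
    rw [iterBr]
    split_ifs
    · exact key X1 A1 1 0 hX1 hA1
    · exact key X2 A2 0 1 hX2 hA2

/-- Up to a permutation of the coordinates, `C` is the graph of a smooth map from an open interval
to the plane. -/
def IsSmoothGraph (C : Set (Fin 3 → ℝ)) : Prop :=
  ∃ (e : Equiv.Perm (Fin 3)) (I : Set ℝ) (g1 g2 : ℝ → ℝ),
    IsOpen I ∧ I.OrdConnected ∧ ContDiffOn ℝ ∞ g1 I ∧ ContDiffOn ℝ ∞ g2 I ∧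
    C = {x : Fin 3 → ℝ | x (e 0) ∈ I ∧ x (e 1) = g1 (x (e 0)) ∧ x (e 2) = g2 (x (e 0))}

theorem isSmoothGraph_empty : IsSmoothGraph ∅ :=
  ⟨1, ∅, 0, 0, isOpen_empty, ordConnected_empty, contDiffOn_const, contDiffOn_const, by simp⟩

theorem exists_isSmoothGraph_mem_nhdsWithin {V : Set (Fin 3 → ℝ)} {p : Fin 3 → ℝ} (hV : IsOpen V)
    (hp : p ∈ V) {φ : (Fin 3 → ℝ) → ℝ} (hφ : ContDiffOn ℝ ∞ φ V) (hp2 : p 2 = 0) (h0 : φ p = 0)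
    (i : Fin 2) (hi : partialDeriv i.castSucc φ p ≠ 0) :
    ∃ C, IsSmoothGraph C ∧ C ∈ 𝓝[{x | x 2 = 0 ∧ φ x = 0}] p := by
  obtain ⟨e, he1, he2⟩ : ∃ e : Equiv.Perm (Fin 3), e 1 = i.castSucc ∧ e 2 = 2 := by
    fin_cases i
    · exact ⟨Equiv.swap 0 1, by decide, by decide⟩
    · exact ⟨1, by decide, by decide⟩
  let L : ℝ × ℝ →L[ℝ] (Fin 3 → ℝ) :=
    (ContinuousLinearMap.fst ℝ ℝ ℝ).smulRight (Pi.single (e 0) 1) +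
      (ContinuousLinearMap.snd ℝ ℝ ℝ).smulRight (Pi.single (e 1) 1)
  have hL : ∀ x : Fin 3 → ℝ, x 2 = 0 → L (x (e 0), x (e 1)) = x := by
    intro x hx
    ext k
    obtain ⟨k, rfl⟩ := e.surjective k
    fin_cases k <;> simp [L, he2.symm ▸ hx]
  have hLp := hL p hp2
  have hw : ∀ᶠ v in 𝓝 (p (e 0), p (e 1)), ContDiffAt ℝ ∞ (φ ∘ L) v := by
    filter_upwards [L.continuous.continuousAt.preimage_mem_nhds
      (hV.mem_nhds (by rwa [hLp]))] with v hv
    exact (hφ.contDiffAt (hV.mem_nhds hv)).comp v L.contDiff.contDiffAt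
  have hd : fderiv ℝ (φ ∘ L) (p (e 0), p (e 1)) (0, 1) ≠ 0 := by
    rw [fderiv_comp _ (by rw [hLp]; exact differentiableAt_of_contDiffOn hV hφ hp)
      L.differentiableAt, hLp, L.fderiv]
    simpa [L, he1, partialDeriv] using hi
  obtain ⟨I, g, hI, hIc, hg, hz⟩ := exists_graph_of_fderiv_ne_zero hw (by simp [hLp, h0]) hd
  refine ⟨{x | x (e 0) ∈ I ∧ x (e 1) = g (x (e 0)) ∧ x (e 2) = 0},
    ⟨e, I, g, fun _ => 0, hI, hIc, hg, contDiffOn_const, rfl⟩, ?_⟩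
  have hpr : ContinuousAt (fun x : Fin 3 → ℝ => (x (e 0), x (e 1))) p := by fun_prop
  rw [mem_nhdsWithin_iff_eventually]
  filter_upwards [hpr.eventually hz] with x hx hxS
  obtain ⟨h1, h2⟩ := hx (by simp [hL x hxS.1, hxS.2])
  exact ⟨h1, h2, by simp [he2, hxS.1]⟩

theorem exists_countable_isSmoothGraph_cover {V : Set (Fin 3 → ℝ)} (hV : IsOpen V)
    {φ : (Fin 3 → ℝ) → ℝ} (hφ : ContDiffOn ℝ ∞ φ V) (i : Fin 2) :
    ∃ T : Set (Set (Fin 3 → ℝ)), T.Countable ∧ (∀ C ∈ T, IsSmoothGraph C) ∧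
      {x ∈ V | x 2 = 0 ∧ φ x = 0 ∧ partialDeriv i.castSucc φ x ≠ 0} ⊆ ⋃₀ T := by
  set S := {x ∈ V | x 2 = 0 ∧ φ x = 0 ∧ partialDeriv i.castSucc φ x ≠ 0}
  have hloc : ∀ p ∈ S, ∃ C, IsSmoothGraph C ∧ C ∈ 𝓝[{x | x 2 = 0 ∧ φ x = 0}] p := fun p hp =>
    exists_isSmoothGraph_mem_nhdsWithin hV hp.1 hφ hp.2.1 hp.2.2.1 i hp.2.2.2
  choose! C hC hCn using hloc
  have hsub : S ⊆ {x | x 2 = 0 ∧ φ x = 0} := fun x hx => ⟨hx.2.1, hx.2.2.1⟩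
  obtain ⟨t, htS, ht, hcov⟩ := TopologicalSpace.countable_cover_nhdsWithin (f := C) (s := S)
    fun p hp => nhdsWithin_mono p hsub (hCn p hp)
  refine ⟨C '' t, ht.image C, ?_, by simpa [sUnion_image] using hcov⟩
  rintro _ ⟨p, hp, rfl⟩
  exact hC p (htS hp)

/-- under the Hörmander condition, the tangency set
`Σ_tan = {x ∈ V : x₃ = 0, A¹(x) = 0, A²(x) = 0}` is covered by countably many sets,
each of which is (after a permutation of the three coordinates) the graph of a smooth
map on an open interval. -/
theorem stmt18 (V : Set (Fin 3 → ℝ)) (hV : IsOpen V)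
    (A1 A2 : (Fin 3 → ℝ) → ℝ)
    (hA1 : ContDiffOn ℝ (⊤ : ℕ∞) A1 V) (hA2 : ContDiffOn ℝ (⊤ : ℕ∞) A2 V)
    (X1 X2 : (Fin 3 → ℝ) → (Fin 3 → ℝ))
    (hX1 : ∀ y, X1 y = ![1, 0, A1 y]) (hX2 : ∀ y, X2 y = ![0, 1, A2 y])
    (hHor : ∀ y ∈ V, ∃ (m : ℕ) (ι : ℕ → Fin 2), iterBr X1 X2 ι m y 2 ≠ 0) :
    ∃ C : ℕ → Set (Fin 3 → ℝ),
      ({x ∈ V | x 2 = 0 ∧ A1 x = 0 ∧ A2 x = 0} ⊆ ⋃ m, C m) ∧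
      ∀ m, ∃ (e : Equiv.Perm (Fin 3)) (I : Set ℝ) (g1 g2 : ℝ → ℝ),
        IsOpen I ∧ I.OrdConnected ∧ ContDiffOn ℝ (⊤ : ℕ∞) g1 I ∧ ContDiffOn ℝ (⊤ : ℕ∞) g2 I ∧
        C m = {x : Fin 3 → ℝ |
          x (e 0) ∈ I ∧ x (e 1) = g1 (x (e 0)) ∧ x (e 2) = g2 (x (e 0))} := by
  have hX1' : X1 = fun y => ![1, 0, A1 y] := funext hX1
  have hX2' : X2 = fun y => ![0, 1, A2 y] := funext hX2
  have hA : ∀ k : Fin 2, ContDiffOn ℝ ∞ (![A1, A2] k) V := by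
    intro k
    fin_cases k
    · exact hA1
    · exact hA2
  choose T hTc hTg hT using fun q : Fin 2 × List (Fin 2) × Fin 2 =>
    exists_countable_isSmoothGraph_cover hV (contDiffOn_iterPartialDeriv hV q.2.1 (hA q.1)) q.2.2
  have hne : (insert ∅ (⋃ q, T q)).Nonempty := insert_nonempty _ _
  obtain ⟨C, hC⟩ := ((countable_iUnion hTc).insert ∅).exists_eq_range hne
  refine ⟨C, ?_, fun m => ?_⟩
  · rintro p ⟨hp, hp2, h1, h2⟩
    obtain ⟨k, l, hl⟩ : ∃ (k : Fin 2) (l : List (Fin 2)), iterPartialDeriv l (![A1, A2] k) p ≠ 0 := by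
      by_contra! h
      obtain ⟨m, ι, hm⟩ := hHor p hp
      obtain ⟨z, hz, hbr⟩ := exists_isFlatAt_iterBr hV hp hX1' hX2' ⟨hA1, h 0⟩ ⟨hA2, h 1⟩ ι m
      have hz0 : z p = 0 := hz.2 []
      exact hm (by simp [hbr hp, hz0])
    have hk : ![A1, A2] k p = 0 := by
      fin_cases k
      · exact h1
      · exact h2
    obtain ⟨l', i, h3, h4⟩ := exists_iterPartialDeriv_eq_zero_and_ne_zero l hk hl
    obtain ⟨D, hD, hpD⟩ := hT (k, l', i) ⟨hp, hp2, h3, h4⟩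
    have : D ∈ range C := hC ▸ mem_insert_of_mem _ (mem_iUnion_of_mem _ hD)
    obtain ⟨m, rfl⟩ := this
    exact mem_iUnion_of_mem m hpD
  · have hm : C m ∈ insert ∅ (⋃ q, T q) := hC ▸ mem_range_self m
    change IsSmoothGraph (C m)
    rcases hm with hm | hm
    · exact hm ▸ isSmoothGraph_empty
    · obtain ⟨q, hq⟩ := mem_iUnion.1 hm
      exact hTg q _ hq
end
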